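/- For every positive integer n, the number of representations of n by x1^2+x2^2+x3^2+x4^2+x5^2 + 3x6^2 + 3x7^2 + 4x8^2 equals (14/5)σ3(n) − (54/5)σ3(n/3) − (238/5)σ3(n/4) + (252/5)σ3(n/8) + (918/5)σ3(n/12) − (448/5)σ3(n/16) − (972/5)σ3(n/24) + (1728/5)σ3(n/48) + (7/20)σ_{3;χ−4,χ−4}(n) + (27/20)σ_{3;χ−4,χ−4}(n/3) − (4/5)a6(n) + (16/5)a6(n/2) − (176/5)a6(n/4) − (1408/5)a6(n/8) + a8(n/2) + 27a8(n/6) + 4a12(n) + 20a12(n/4) + (1/4)a16(n) − (27/4)a16(n/3) + 9·χ4(n/2)·a24(n/2) + (22/5)·χ−4(n)·a6(n) + (5/4)·χ−4(n)·a12(n) − (9/4)·χ−4(n)·a24(n), with all terms whose argument is not a positive integer interpreted as 0. -/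

import Mathlib

open Complex Real Finset

/-- The Dedekind eta function `η(z) = q^{1/24} ∏ (1 - q^m)`, `q = e^{2πiz}`. -/
noncomputable def dedekindEta (z : ℂ) : ℂ :=
  Complex.exp (Real.pi * Complex.I * z / 12) *
    ∏' m : ℕ, (1 - Complex.exp (2 * Real.pi * Complex.I * (m + 1) * z))

/-- `repCount a n` is the number of `(x₁,…,x₈) ∈ ℤ⁸` with `∑ aᵢ xᵢ² = n`. -/
noncomputable def repCount (a : Fin 8 → ℕ) (n : ℕ) : ℕ :=
  Nat.card {x : Fin 8 → ℤ // ∑ i, (a i : ℤ) * x i ^ 2 = (n : ℤ)}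

/-- `σ₃(n) = ∑_{d ∣ n} d³`. -/
def sigma3 (n : ℕ) : ℤ := ∑ d ∈ n.divisors, (d : ℤ) ^ 3

/-- `σ_{3;χ₋₄,χ₋₄}(n) = ∑_{d ∣ n} χ₋₄(d) χ₋₄(n/d) d³`. -/
def sigmaChi4Chi4 (n : ℕ) : ℤ :=
  ∑ d ∈ n.divisors, ZMod.χ₄ (d : ZMod 4) * ZMod.χ₄ ((n / d : ℕ) : ZMod 4) * (d : ℤ) ^ 3

/-- `χ₋₄ = (−4/·)`, the nontrivial character mod 4, as an integer-valued function on `ℕ`. -/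
def chiMinus4 (n : ℕ) : ℤ := ZMod.χ₄ (n : ZMod 4)

/-- `χ₄ = (4/·)`: `1` on odd integers, `0` on even integers. -/
def chi4 (n : ℕ) : ℤ := if n % 2 = 1 then 1 else 0

/-- `f(n/k)` when `k ∣ n`, and `0` otherwise. -/
def Dv (f : ℕ → ℤ) (k n : ℕ) : ℚ := if k ∣ n then (f (n / k) : ℚ) else 0

/-! ### Theta functions -/

/-- The exponential `e^{πi r τ}`. -/
noncomputable def ee (τ r : ℂ) : ℂ := Complex.exp (π * I * r * τ)

lemma ee_add (τ r s : ℂ) : ee τ (r + s) = ee τ r * ee τ s := by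
  rw [ee, ee, ee, ← Complex.exp_add]; ring_nf

lemma ee_mul (c τ r : ℂ) : ee (c * τ) r = ee τ (c * r) := by
  rw [ee, ee]; ring_nf

lemma ee_ne (τ r : ℂ) : ee τ r ≠ 0 := Complex.exp_ne_zero _

/-- `θ₃`. -/
noncomputable def t3 (τ : ℂ) : ℂ := jacobiTheta₂ 0 τ
/-- `θ₄`. -/
noncomputable def t4 (τ : ℂ) : ℂ := jacobiTheta₂ (1 / 2) τ
/-- `θ₂`. -/
noncomputable def t2 (τ : ℂ) : ℂ := Complex.exp (π * I * τ / 4) * jacobiTheta₂ (τ / 2) τ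

lemma hs3 {τ : ℂ} (h : 0 < τ.im) : HasSum (fun n : ℤ => ee τ ((n : ℂ) ^ 2)) (t3 τ) := by
  refine (hasSum_jacobiTheta₂_term 0 h).congr_fun ?_
  intro n
  rw [jacobiTheta₂_term, ee]; ring_nf

lemma hs2 {τ : ℂ} (h : 0 < τ.im) : HasSum (fun n : ℤ => ee τ (((n : ℂ) + 1 / 2) ^ 2)) (t2 τ) := by
  refine ((hasSum_jacobiTheta₂_term (τ / 2) h).mul_left (Complex.exp (π * I * τ / 4))).congr_fun ?_
  intro n
  rw [jacobiTheta₂_term, ee, ← Complex.exp_add]; ring_nf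

/-- `(-1)^n` as a complex number. -/
noncomputable def sg (n : ℤ) : ℂ := (-1 : ℂ) ^ n

lemma exp_pi_int (n : ℤ) : Complex.exp (π * I * n) = sg n := by
  rw [sg, mul_comm, Complex.exp_int_mul, Complex.exp_pi_mul_I]

lemma hs4 {τ : ℂ} (h : 0 < τ.im) : HasSum (fun n : ℤ => sg n * ee τ ((n : ℂ) ^ 2)) (t4 τ) := by
  refine (hasSum_jacobiTheta₂_term (1 / 2) h).congr_fun ?_
  intro n
  rw [jacobiTheta₂_term, ee, ← exp_pi_int, ← Complex.exp_add]; ring_nf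

lemma sg_sq (n : ℤ) : sg (n ^ 2) = sg n := by
  rw [sg, sg]
  rcases Int.even_or_odd n with h | h
  · rw [h.neg_one_zpow, (Even.pow_of_ne_zero h two_ne_zero).neg_one_zpow]
  · rw [h.neg_one_zpow, (Odd.pow h).neg_one_zpow]

lemma ee_one_int (n : ℤ) : ee 1 n = sg n := by rw [ee, ← exp_pi_int]; ring_nf

lemma ee_add_left (τ σ r : ℂ) : ee (τ + σ) r = ee τ r * ee σ r := by
  rw [ee, ee, ee, ← Complex.exp_add]; ring_nf

lemma t3_add_one {τ : ℂ} (h : 0 < τ.im) : t3 (τ + 1) = t4 τ := by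
  have h' : 0 < (τ + 1).im := by simpa using h
  refine (hs3 h').unique ((hs4 h).congr_fun ?_)
  intro n
  have := ee_one_int (n ^ 2)
  push_cast at this
  rw [ee_add_left, this, sg_sq, mul_comm]

lemma t4_add_one {τ : ℂ} (h : 0 < τ.im) : t4 (τ + 1) = t3 τ := by
  have h' : 0 < (τ + 1).im := by simpa using h
  refine (hs4 h').unique ((hs3 h).congr_fun ?_)
  intro n
  have := ee_one_int (n ^ 2)
  push_cast at this
  have h2 : sg n * sg n = 1 := by
    rw [sg, ← mul_zpow]; simp
  rw [ee_add_left, this, sg_sq, mul_comm, mul_assoc, h2, mul_one]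

lemma t2_add_one {τ : ℂ} (h : 0 < τ.im) : t2 (τ + 1) = Complex.exp (π * I / 4) * t2 τ := by
  have h' : 0 < (τ + 1).im := by simpa using h
  refine (hs2 h').unique (((hs2 h).mul_left _).congr_fun ?_)
  intro n
  have h2 : ee 1 (((n : ℂ) + 1 / 2) ^ 2) = Complex.exp (π * I / 4) := by
    have : ((n : ℂ) + 1 / 2) ^ 2 = ((n ^ 2 + n : ℤ) : ℂ) + 1 / 4 := by push_cast; ring
    rw [this, ee_add, ee_one_int, sg, Even.neg_one_zpow, one_mul, ee]
    · ring_nf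
    · have := Int.even_mul_succ_self n
      rwa [show n ^ 2 + n = n * (n + 1) by ring]
  rw [ee_add_left, h2, mul_comm]

lemma hasSum_split {α β γ : Type*} (i : α → γ) (j : β → γ) (hi : Function.Injective i)
    (hj : Function.Injective j) (hc : IsCompl (Set.range i) (Set.range j)) {f : γ → ℂ} {A B : ℂ}
    (hA : HasSum (fun x => f (i x)) A) (hB : HasSum (fun x => f (j x)) B) : HasSum f (A + B) := by
  refine HasSum.add_isCompl hc ?_ ?_
  · exact (hi.hasSum_range_iff (f := f)).2 hA
  · exact (hj.hasSum_range_iff (f := f)).2 hB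

lemma split_int {f : ℤ → ℂ} {A B : ℂ} (hA : HasSum (fun n : ℤ => f (2 * n)) A)
    (hB : HasSum (fun n : ℤ => f (2 * n + 1)) B) : HasSum f (A + B) := by
  refine hasSum_split _ _ ?_ ?_ ?_ hA hB
  · intro a b h; omega
  · intro a b h; have h : _ = _ := h; dsimp only at h; omega
  · rw [isCompl_iff, Set.disjoint_iff_forall_ne, codisjoint_iff]
    refine ⟨?_, ?_⟩
    · rintro _ ⟨a, rfl⟩ _ ⟨b, rfl⟩; intro h; dsimp only at h; omega
    · ext n
      simp only [Set.sup_eq_union, Set.top_eq_univ, Set.mem_union, Set.mem_range, Set.mem_univ, iff_true]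
      rcases Int.even_or_odd' n with ⟨k, h | h⟩
      · exact Or.inl ⟨k, h.symm⟩
      · exact Or.inr ⟨k, h.symm⟩

lemma split_int2 {f : ℤ × ℤ → ℂ} {A B : ℂ}
    (hA : HasSum (fun p : ℤ × ℤ => f (p.1 + p.2, p.1 - p.2)) A)
    (hB : HasSum (fun p : ℤ × ℤ => f (p.1 + p.2 + 1, p.1 - p.2)) B) : HasSum f (A + B) := by
  refine hasSum_split _ _ ?_ ?_ ?_ hA hB
  · rintro ⟨a, b⟩ ⟨c, d⟩ h; simp only [Prod.mk.injEq] at h ⊢; omega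
  · rintro ⟨a, b⟩ ⟨c, d⟩ h; simp only [Prod.mk.injEq] at h ⊢; omega
  · rw [isCompl_iff, Set.disjoint_iff_forall_ne, codisjoint_iff]
    refine ⟨?_, ?_⟩
    · rintro _ ⟨a, rfl⟩ _ ⟨b, rfl⟩; simp only [ne_eq, Prod.mk.injEq]; omega
    · ext ⟨m, n⟩
      simp only [Set.sup_eq_union, Set.top_eq_univ, Set.mem_union, Set.mem_range, Set.mem_univ, iff_true, Prod.mk.injEq, Prod.exists]
      rcases Int.even_or_odd' (m + n) with ⟨k, h | h⟩
      · exact Or.inl ⟨k, m - k, by omega, by omega⟩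
      · exact Or.inr ⟨k, m - k - 1, by omega, by omega⟩

lemma hasSum_mul {α β : Type*} {f : α → ℂ} {g : β → ℂ} {a b : ℂ} (hf : HasSum f a)
    (hg : HasSum g b) : HasSum (fun p : α × β => f p.1 * g p.2) (a * b) :=
  hf.mul hg (summable_mul_of_summable_norm hf.summable.norm hg.summable.norm)

lemma im_mul_pos {τ : ℂ} (h : 0 < τ.im) (k : ℕ) [NeZero k] : 0 < ((k : ℂ) * τ).im := by
  have : (0 : ℝ) < k := by exact_mod_cast Nat.pos_of_ne_zero (NeZero.ne k)
  simp only [mul_im, natCast_re, natCast_im, zero_mul, add_zero]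
  positivity

lemma im2 {τ : ℂ} (h : 0 < τ.im) : 0 < (2 * τ).im := im_mul_pos h 2
lemma im3 {τ : ℂ} (h : 0 < τ.im) : 0 < (3 * τ).im := im_mul_pos h 3
lemma im4 {τ : ℂ} (h : 0 < τ.im) : 0 < (4 * τ).im := im_mul_pos h 4

lemma t3_four {τ : ℂ} (h : 0 < τ.im) : t3 τ = t3 (4 * τ) + t2 (4 * τ) := by
  refine (hs3 h).unique (split_int ?_ ?_)
  · refine (hs3 (im4 h)).congr_fun ?_
    intro n; rw [ee_mul]; push_cast; ring_nf
  · refine (hs2 (im4 h)).congr_fun ?_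
    intro n; rw [ee_mul]; push_cast; ring_nf

lemma sg_even (n : ℤ) : sg (2 * n) = 1 := by rw [sg, Even.neg_one_zpow (by simp)]
lemma sg_odd (n : ℤ) : sg (2 * n + 1) = -1 := by rw [sg, Odd.neg_one_zpow (by simp)]

lemma t4_four {τ : ℂ} (h : 0 < τ.im) : t4 τ = t3 (4 * τ) - t2 (4 * τ) := by
  rw [sub_eq_add_neg]
  refine (hs4 h).unique (split_int ?_ ?_)
  · refine (hs3 (im4 h)).congr_fun ?_
    intro n; rw [ee_mul, sg_even]; push_cast; ring_nf
  · refine (hs2 (im4 h)).neg.congr_fun ?_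
    intro n; rw [ee_mul, sg_odd]; push_cast; ring_nf

lemma t3_sq {τ : ℂ} (h : 0 < τ.im) : t3 τ ^ 2 = t3 (2 * τ) ^ 2 + t2 (2 * τ) ^ 2 := by
  rw [sq, sq, sq]
  refine (hasSum_mul (hs3 h) (hs3 h)).unique (split_int2 ?_ ?_)
  · refine (hasSum_mul (hs3 (im2 h)) (hs3 (im2 h))).congr_fun ?_
    intro n; rw [← ee_add, ← ee_add, ee_mul]; push_cast; ring_nf
  · refine (hasSum_mul (hs2 (im2 h)) (hs2 (im2 h))).congr_fun ?_
    intro n; rw [← ee_add, ← ee_add, ee_mul]; push_cast; ring_nf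

lemma cubic_aux {τ : ℂ} (h : 0 < τ.im) :
    t3 τ * t3 (3 * τ) = t2 τ * t2 (3 * τ) + t4 τ * t4 (3 * τ) := by
  have hsum := (hasSum_mul (hs3 h) (hs3 (im3 h))).summable
  have hE : Summable (fun p : ℤ × ℤ => ee τ (((p.1 + p.2 : ℤ) : ℂ) ^ 2 + 3 * ((p.1 - p.2 : ℤ) : ℂ) ^ 2)) := by
    have : Function.Injective (fun p : ℤ × ℤ => (p.1 + p.2, p.1 - p.2)) := by
      rintro ⟨a, b⟩ ⟨c, d⟩ h; simp only [Prod.mk.injEq] at h ⊢; omega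
    refine (hsum.comp_injective this).congr ?_
    intro p; simp only [Function.comp, ee_add, ee_mul]
  have hO : Summable (fun p : ℤ × ℤ => ee τ (((p.1 + p.2 + 1 : ℤ) : ℂ) ^ 2 + 3 * ((p.1 - p.2 : ℤ) : ℂ) ^ 2)) := by
    have : Function.Injective (fun p : ℤ × ℤ => (p.1 + p.2 + 1, p.1 - p.2)) := by
      rintro ⟨a, b⟩ ⟨c, d⟩ h; simp only [Prod.mk.injEq] at h ⊢; omega
    refine (hsum.comp_injective this).congr ?_
    intro p; simp only [Function.comp, ee_add, ee_mul]
  obtain ⟨E, hE⟩ := hE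
  obtain ⟨O, hO⟩ := hO
  have h3 : t3 τ * t3 (3 * τ) = E + O := by
    refine (hasSum_mul (hs3 h) (hs3 (im3 h))).unique (split_int2 ?_ ?_)
    · refine hE.congr_fun ?_
      intro p; simp only [ee_add, ee_mul]
    · refine hO.congr_fun ?_
      intro p; simp only [ee_add, ee_mul]
  have hsg : ∀ a b : ℤ, sg a * sg b = sg (a + b) := by
    intro a b; rw [sg, sg, sg, zpow_add₀ (by norm_num)]
  have h4 : t4 τ * t4 (3 * τ) = E + -O := by
    refine (hasSum_mul (hs4 h) (hs4 (im3 h))).unique (split_int2 ?_ ?_)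
    · refine hE.congr_fun ?_
      intro p
      rw [mul_mul_mul_comm, hsg, show p.1 + p.2 + (p.1 - p.2) = 2 * p.1 by ring, sg_even, one_mul,
        ee_add, ee_mul]
    · refine hO.neg.congr_fun ?_
      intro p
      rw [mul_mul_mul_comm, hsg, show p.1 + p.2 + 1 + (p.1 - p.2) = 2 * p.1 + 1 by ring, sg_odd,
        ee_add, ee_mul]; ring
  have h2 : t2 τ * t2 (3 * τ) = O + O := by
    refine (hasSum_mul (hs2 h) (hs2 (im3 h))).unique (split_int2 ?_ ?_)
    · let e : ℤ × ℤ ≃ ℤ × ℤ := ⟨fun p => (p.1, p.1 - p.2), fun p => (p.1, p.1 - p.2),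
        fun p => by ext <;> simp, fun p => by ext <;> simp⟩
      refine (e.hasSum_iff.2 hO).congr_fun ?_
      intro p
      simp only [Function.comp, e, Equiv.coe_fn_mk, ee_mul, ← ee_add]
      congr 1; push_cast; ring
    · let e : ℤ × ℤ ≃ ℤ × ℤ := ⟨fun p => (p.2, p.2 - p.1 - 1), fun p => (p.1 - p.2 - 1, p.1),
        fun p => by ext <;> simp <;> ring, fun p => by ext <;> simp <;> ring⟩
      refine (e.hasSum_iff.2 hO).congr_fun ?_
      intro p
      simp only [Function.comp, e, Equiv.coe_fn_mk, ee_mul, ← ee_add]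
      congr 1; push_cast; ring
  rw [h2, h3, h4]; ring

lemma t3_add_two {τ : ℂ} (h : 0 < τ.im) : t3 (τ + 2) = t3 τ := by
  have h' : 0 < (τ + 1).im := by simpa using h
  rw [show τ + 2 = (τ + 1) + 1 by ring, t3_add_one h', t4_add_one h]

lemma exp_pi_I_half : Complex.exp (π * I / 4) ^ 2 = I := by
  rw [← Complex.exp_nat_mul, show ((2 : ℕ) : ℂ) * (π * I / 4) = π / 2 * I by push_cast; ring,
    Complex.exp_pi_div_two_mul_I]

lemma t2_add_two {τ : ℂ} (h : 0 < τ.im) : t2 (τ + 2) = I * t2 τ := by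
  have h' : 0 < (τ + 1).im := by simpa using h
  rw [show τ + 2 = (τ + 1) + 1 by ring, t2_add_one h', t2_add_one h, ← mul_assoc, ← sq,
    exp_pi_I_half]

lemma t4_sq {τ : ℂ} (h : 0 < τ.im) : t4 τ ^ 2 = t3 (2 * τ) ^ 2 - t2 (2 * τ) ^ 2 := by
  have h' : 0 < (τ + 1).im := by simpa using h
  rw [← t3_add_one h, t3_sq h', show 2 * (τ + 1) = 2 * τ + 2 by ring, t3_add_two (im2 h),
    t2_add_two (im2 h), mul_pow, I_sq]
  ring

lemma t3_mul_t4 {τ : ℂ} (h : 0 < τ.im) : t3 τ * t4 τ = t4 (2 * τ) ^ 2 := by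
  rw [t3_four h, t4_four h, t4_sq (im2 h), show 2 * (2 * τ) = 4 * τ by ring]
  ring

lemma t2_sq {τ : ℂ} (h : 0 < τ.im) : t2 τ ^ 2 = 2 * t2 (2 * τ) * t3 (2 * τ) := by
  have h' : 0 < (τ / 2).im := by
    have : (τ / 2).im = τ.im / 2 := by simp
    rw [this]; positivity
  have e1 := t3_sq h'
  have e2 := t4_sq h'
  have e3 := t3_four h'
  have e4 := t4_four h'
  rw [show 2 * (τ / 2) = τ by ring] at e1 e2
  rw [show 4 * (τ / 2) = 2 * τ by ring] at e3 e4
  rw [e3] at e1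
  rw [e4] at e2
  linear_combination (e2 - e1) / 2

lemma t_quartic {τ : ℂ} (h : 0 < τ.im) : t3 τ ^ 4 = t2 τ ^ 4 + t4 τ ^ 4 := by
  have h' : 0 < (τ / 2).im := by
    have : (τ / 2).im = τ.im / 2 := by simp
    rw [this]; positivity
  have e1 := t3_sq h'
  have e2 := t4_sq h'
  have e3 := t3_mul_t4 h'
  rw [show 2 * (τ / 2) = τ by ring] at e1 e2 e3
  have : (t3 (τ / 2) * t4 (τ / 2)) ^ 2 = (t3 τ ^ 2 + t2 τ ^ 2) * (t3 τ ^ 2 - t2 τ ^ 2) := by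
    rw [mul_pow, e1, e2]
  rw [e3] at this
  linear_combination -this

/-- The automorphy factor of weight one half. -/
noncomputable def rt (τ : ℂ) : ℂ := (-I * τ) ^ (1 / 2 : ℂ)

lemma rt_sq (τ : ℂ) : rt τ ^ 2 = -I * τ := by
  rw [rt, ← Complex.cpow_nat_mul]; simp

lemma ne_zero_of_im {τ : ℂ} (h : 0 < τ.im) : τ ≠ 0 := by
  rintro rfl; simp at h

lemma rt_ne {τ : ℂ} (h : 0 < τ.im) : rt τ ≠ 0 := by
  intro h0
  have := rt_sq τ
  rw [h0] at this
  have h1 := ne_zero_of_im h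
  simp [h1] at this

lemma im_S {τ : ℂ} (h : 0 < τ.im) : 0 < (-1 / τ).im := by
  rw [neg_div, neg_im, one_div, inv_im, neg_div, neg_neg]
  exact div_pos h (normSq_pos.2 (ne_zero_of_im h))

lemma t3_S {τ : ℂ} (h : 0 < τ.im) : t3 (-1 / τ) = rt τ * t3 τ := by
  have e := jacobiTheta₂_functional_equation 0 τ
  have hr := rt_ne h
  rw [t3, t3, e]
  change _ = rt τ * (1 / rt τ * _ * _)
  field_simp
  simp

lemma t2_S {τ : ℂ} (h : 0 < τ.im) : t2 (-1 / τ) = rt τ * t4 τ := by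
  have e := jacobiTheta₂_functional_equation (1 / 2) τ
  have hr := rt_ne h
  have h0 := ne_zero_of_im h
  rw [t2, t4, e, ← jacobiTheta₂_neg_left]
  change _ = rt τ * (1 / rt τ * _ * _)
  rw [show -(-1 / τ / 2) = 1 / 2 / τ by field_simp,
    show π * I * (-1 / τ) / 4 = -π * I * (1 / 2) ^ 2 / τ by field_simp; norm_num]
  field_simp

lemma t4_S {τ : ℂ} (h : 0 < τ.im) : t4 (-1 / τ) = rt τ * t2 τ := by
  have e := jacobiTheta₂_functional_equation (τ / 2) τ
  have hr := rt_ne h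
  have h0 := ne_zero_of_im h
  rw [t2, t4, e]
  change _ = rt τ * (_ * (1 / rt τ * _ * _))
  rw [show τ / 2 / τ = 1 / 2 by field_simp,
    show -π * I * (τ / 2) ^ 2 / τ = -(π * I * τ / 4) by field_simp; norm_num, Complex.exp_neg]
  have := Complex.exp_ne_zero (π * I * τ / 4)
  field_simp

/-- The filter of neighbourhoods of `i∞`. -/
noncomputable def Linf : Filter ℂ := Filter.comap Complex.im Filter.atTop

instance : Linf.NeBot := by
  rw [Linf]
  refine Filter.NeBot.comap_of_surj inferInstance ?_
  intro y; exact ⟨⟨0, y⟩, rfl⟩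

lemma Linf_pos : ∀ᶠ τ in Linf, 0 < τ.im :=
  Filter.tendsto_comap.eventually (Filter.eventually_gt_atTop 0)

lemma Linf_mul {c : ℝ} (hc : 0 < c) : Filter.Tendsto (fun τ : ℂ => (c : ℂ) * τ) Linf Linf := by
  rw [Linf, Filter.tendsto_comap_iff]
  have : Complex.im ∘ (fun τ : ℂ => (c : ℂ) * τ) = fun τ => c * τ.im := by
    ext τ; simp
  rw [this]
  exact Filter.Tendsto.const_mul_atTop hc Filter.tendsto_comap

lemma Linf_add (c : ℝ) : Filter.Tendsto (fun τ : ℂ => τ + c) Linf Linf := by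
  rw [Linf, Filter.tendsto_comap_iff]
  have : Complex.im ∘ (fun τ : ℂ => τ + c) = fun τ => τ.im := by
    ext τ; simp
  rw [this]
  exact Filter.tendsto_comap

lemma t3_lim : Filter.Tendsto t3 Linf (nhds 1) := by
  have h := isBigO_at_im_infty_jacobiTheta_sub_one
  have h0 : Filter.Tendsto (fun τ : ℂ => Real.exp (-π * τ.im)) Linf (nhds 0) := by
    refine Real.tendsto_exp_atBot.comp ?_
    exact Filter.Tendsto.const_mul_atTop_of_neg (by simpa using Real.pi_pos) Filter.tendsto_comap
  have := (h.trans_tendsto h0).add_const 1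
  simp only [jacobiTheta_eq_jacobiTheta₂, sub_add_cancel, zero_add] at this
  exact this

lemma t4_lim : Filter.Tendsto t4 Linf (nhds 1) := by
  have h := t3_lim.comp (Linf_add 1)
  refine h.congr' ?_
  filter_upwards [Linf_pos] with τ hτ
  simpa using t3_add_one hτ

/-- `θ₂` divided by its leading exponential. -/
noncomputable def t2n (τ : ℂ) : ℂ := jacobiTheta₂ (τ / 2) τ

lemma t2_eq (τ : ℂ) : t2 τ = Complex.exp (π * I * τ / 4) * t2n τ := rfl

lemma t2n_lim : Filter.Tendsto t2n Linf (nhds 2) := by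
  have hsum : Summable (fun n : ℤ => ‖jacobiTheta₂_term n (I / 2) I‖) :=
    (hasSum_jacobiTheta₂_term (I / 2) (by simp : 0 < I.im)).summable.norm
  have hnorm : ∀ (n : ℤ) (τ : ℂ), ‖jacobiTheta₂_term n (τ / 2) τ‖
      = Real.exp (-π * (n * (n + 1)) * τ.im) := by
    intro n τ
    rw [norm_jacobiTheta₂_term]
    congr 1
    simp
    ring
  have hnn : ∀ n : ℤ, (0 : ℝ) ≤ n * (n + 1) := by
    intro n
    have : (0 : ℤ) ≤ n * (n + 1) := by
      rcases le_or_gt 0 n with h | h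
      · positivity
      · nlinarith
    exact_mod_cast this
  have key := tendsto_tsum_of_dominated_convergence (𝓕 := Linf) (β := ℤ)
    (f := fun τ n => jacobiTheta₂_term n (τ / 2) τ)
    (g := fun n => if n = 0 ∨ n = -1 then (1 : ℂ) else 0) hsum ?_ ?_
  · have hg : ∑' n : ℤ, (if n = 0 ∨ n = -1 then (1 : ℂ) else 0) = 2 := by
      rw [tsum_eq_sum (s := {0, -1})]
      · rw [Finset.sum_pair (by norm_num)]; norm_num
      · intro b hb; simp at hb; simp [hb]
    rw [hg] at key
    exact key
  · intro n
    by_cases hn : n = 0 ∨ n = -1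
    · simp only [hn, if_true]
      refine tendsto_const_nhds.congr ?_
      intro τ
      rcases hn with rfl | rfl
      · simp [jacobiTheta₂_term]
      · rw [jacobiTheta₂_term]
        push_cast
        rw [show 2 * (π : ℂ) * I * -1 * (τ / 2) + π * I * (-1) ^ 2 * τ = 0 by ring, Complex.exp_zero]
    · simp only [hn, if_false]
      rw [tendsto_zero_iff_norm_tendsto_zero]
      simp_rw [hnorm]
      refine Real.tendsto_exp_atBot.comp ?_
      refine Filter.Tendsto.const_mul_atTop_of_neg ?_ Filter.tendsto_comap
      have : (0 : ℝ) < n * (n + 1) := by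
        refine lt_of_le_of_ne (hnn n) ?_
        intro h
        rcases mul_eq_zero.1 h.symm with h | h
        · exact hn (Or.inl (by exact_mod_cast h))
        · refine hn (Or.inr ?_)
          have : n + 1 = 0 := by exact_mod_cast h
          omega
      have := Real.pi_pos
      nlinarith [mul_pos Real.pi_pos ‹(0 : ℝ) < n * (n + 1)›]
  · have : ∀ᶠ τ in Linf, 1 ≤ τ.im := Filter.tendsto_comap.eventually (Filter.eventually_ge_atTop 1)
    filter_upwards [this] with τ hτ n
    rw [hnorm, hnorm]
    apply Real.exp_le_exp.2
    have := mul_nonneg Real.pi_pos.le (hnn n)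
    simp only [I_im, mul_one]
    nlinarith

lemma t3_diff {τ : ℂ} (h : 0 < τ.im) : DifferentiableAt ℂ t3 τ := differentiableAt_jacobiTheta₂_snd 0 h
lemma t4_diff {τ : ℂ} (h : 0 < τ.im) : DifferentiableAt ℂ t4 τ :=
  differentiableAt_jacobiTheta₂_snd (1 / 2) h
lemma t2n_diff {τ : ℂ} (h : 0 < τ.im) : DifferentiableAt ℂ t2n τ := by
  have h1 := (hasFDerivAt_jacobiTheta₂ (τ / 2) h).differentiableAt
  have h2 : DifferentiableAt ℂ (fun τ : ℂ => (τ / 2, τ)) τ := by fun_prop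
  exact DifferentiableAt.comp (f := fun τ : ℂ => (τ / 2, τ)) τ h1 h2
lemma t2_diff {τ : ℂ} (h : 0 < τ.im) : DifferentiableAt ℂ t2 τ := by
  have h1 := t2n_diff h
  have : t2 = fun τ => Complex.exp (π * I * τ / 4) * t2n τ := by ext τ; exact t2_eq τ
  rw [this]
  fun_prop

open UpperHalfPlane ModularForm MatrixGroups in
/-- A function on the upper half plane with level one weight `k < 12` transformation behaviour
and vanishing at the cusp is zero. -/
lemma level_one_zero {F : ℂ → ℂ} {k : ℤ} (hk : k < 12)
    (hd : ∀ τ : ℂ, 0 < τ.im → DifferentiableAt ℂ F τ)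
    (hT : ∀ τ : ℂ, 0 < τ.im → F (τ + 1) = F τ)
    (hS : ∀ τ : ℂ, 0 < τ.im → F (-1 / τ) = τ ^ k * F τ)
    (hlim : Filter.Tendsto F Linf (nhds 0)) (τ : ℂ) (hτ : 0 < τ.im) : F τ = 0 := by
  let f : ℍ → ℂ := fun z => F z
  have hS' : f ∣[k] ModularGroup.S = f := by
    ext z
    rw [SL_slash_apply, UpperHalfPlane.modular_S_smul]
    have h1 : f (UpperHalfPlane.mk (-(z : ℂ))⁻¹ z.im_inv_neg_coe_pos) = (z : ℂ) ^ k * f z := by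
      have := hS z z.im_pos
      change F _ = _
      rw [← this]
      congr 1
      simp [neg_div, inv_neg]
    rw [h1]
    have h2 : denom ModularGroup.S z = z := ModularGroup.denom_S _
    rw [h2, mul_comm, ← mul_assoc, ← zpow_add₀ z.ne_zero]
    simp
  have hT' : f ∣[k] ModularGroup.T = f := by
    ext z
    rw [SL_slash_apply]
    have h2 : denom ModularGroup.T z = 1 := by
      rw [ModularGroup.denom_apply]; simp [ModularGroup.T]
    rw [h2, UpperHalfPlane.modular_T_smul]
    simp only [one_zpow, mul_one]
    change F _ = F _
    rw [← hT z z.im_pos]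
    congr 1
    simp [add_comm]
  have hγ := SlashInvariantForm.slash_action_generators_SL2Z hS' hT'
  have htend : Filter.Tendsto (fun z : ℍ => (z : ℂ)) atImInfty Linf := by
    rw [Linf, Filter.tendsto_comap_iff]
    exact Filter.tendsto_comap
  let g : CuspForm 𝒮ℒ k :=
    { toFun := f
      slash_action_eq' := fun A ⟨γ, h⟩ => h ▸ hγ γ
      holo' := by
        rw [UpperHalfPlane.mdifferentiable_iff]
        refine DifferentiableOn.congr (f := F) (fun z hz => (hd z hz).differentiableWithinAt) ?_
        intro z hz
        simp [f, ofComplex_apply_of_im_pos hz]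
      zero_at_cusps' := fun {c} hc => by
        rw [Subgroup.IsArithmetic.isCusp_iff_isCusp_SL2Z] at hc
        rw [OnePoint.isZeroAt_iff_forall_SL2Z hc]
        intro γ _
        rw [hγ]
        exact hlim.comp htend }
  have hg : g = 0 := by
    have := CuspForm.rank_eq_zero_of_weight_lt_twelve hk
    rw [rank_zero_iff] at this
    exact Subsingleton.elim _ _
  have := congrArg (fun h : CuspForm 𝒮ℒ k => h ⟨τ, hτ⟩) hg
  exact this

/-- The product in the definition of eta. -/
noncomputable def etaP (z : ℂ) : ℂ :=
  ∏' m : ℕ, (1 - Complex.exp (2 * Real.pi * Complex.I * (m + 1) * z))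

lemma eta_eq (z : ℂ) : dedekindEta z = Complex.exp (π * I * z / 12) * etaP z := rfl

lemma eta_eq_mathlib (z : ℂ) : dedekindEta z = ModularForm.eta z := by
  rw [dedekindEta, ModularForm.eta]
  congr 1
  · rw [Function.Periodic.qParam]; congr 1; push_cast; ring
  · congr 1; ext n; rw [ModularForm.eta_q_eq_cexp]

lemma etaP_eq (z : ℂ) : etaP z = ∏' n, (1 - ModularForm.eta_q n z) := by
  rw [etaP]
  congr 1; ext n; rw [ModularForm.eta_q_eq_cexp]

lemma eta_ne {z : ℂ} (h : 0 < z.im) : dedekindEta z ≠ 0 := by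
  rw [eta_eq_mathlib]; exact ModularForm.eta_ne_zero h

lemma etaP_diff {z : ℂ} (h : 0 < z.im) : DifferentiableAt ℂ etaP z := by
  rw [show etaP = _ from funext etaP_eq]
  exact ModularForm.differentiableAt_eta_tprod h

lemma etaP_ne {z : ℂ} (h : 0 < z.im) : etaP z ≠ 0 := by
  rw [etaP_eq]
  exact ModularForm.eta_tprod_ne_zero h

lemma eta_diff {z : ℂ} (h : 0 < z.im) : DifferentiableAt ℂ dedekindEta z := by
  rw [show dedekindEta = _ from funext eta_eq_mathlib]
  exact ModularForm.differentiableAt_eta_of_mem_upperHalfPlaneSet h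

lemma q_lim : Filter.Tendsto (fun z : ℂ => Complex.exp (2 * π * I * z)) Linf (nhds 0) := by
  rw [tendsto_zero_iff_norm_tendsto_zero]
  have : (fun z : ℂ => ‖Complex.exp (2 * π * I * z)‖) = fun z => Real.exp ((-2 * π) * z.im) := by
    ext z; rw [Complex.norm_exp]; simp
  rw [this]
  refine Real.tendsto_exp_atBot.comp ?_
  exact Filter.Tendsto.const_mul_atTop_of_neg (by have := Real.pi_pos; linarith) Filter.tendsto_comap

lemma etaP_lim : Filter.Tendsto etaP Linf (nhds 1) := by
  have htprod : Filter.Tendsto (fun q : ℂ ↦ ∏' (n : ℕ), (1 - q ^ (n + 1))) (nhds 0) (nhds 1) := by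
    have := tendsto_tprod_one_add_of_dominated_convergence (𝓕 := nhds 0) (g := 0)
      (f := fun (q : ℂ) (n : ℕ) ↦ -q ^ (n + 1)) (bound := fun n ↦ (1 / 2 : ℝ) ^ (n + 1))
    simp only [Pi.zero_apply, norm_neg, norm_pow, add_zero, tprod_one] at this
    simp_rw [sub_eq_add_neg]
    refine this
      (by simpa only [pow_succ'] using (summable_geometric_of_abs_lt_one (by norm_num)).mul_left _)
      (fun k ↦ by simpa using ((continuous_pow (M := ℂ) (k + 1)).tendsto 0).neg) ?_
    filter_upwards [Metric.ball_mem_nhds (0 : ℂ) (by norm_num : (0 : ℝ) < 1 / 2)] with q hq k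
    exact pow_le_pow_left₀ (norm_nonneg _) (mem_ball_zero_iff.mp hq).le _
  refine (htprod.comp q_lim).congr ?_
  intro z
  rw [etaP_eq]
  simp only [Function.comp, ModularForm.eta_q_eq_pow]

open UpperHalfPlane ModularForm MatrixGroups in
lemma eta24_S {τ : ℂ} (h : 0 < τ.im) : dedekindEta (-1 / τ) ^ 24 = τ ^ 12 * dedekindEta τ ^ 24 := by
  have e := congrFun discriminant_S_invariant ⟨τ, h⟩
  rw [SL_slash_apply, UpperHalfPlane.modular_S_smul] at e
  have h2 : denom ModularGroup.S (⟨τ, h⟩ : ℍ) = τ := ModularGroup.denom_S _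
  rw [h2, discriminant, discriminant] at e
  have h0 := ne_zero_of_im h
  simp only [← eta_eq_mathlib] at e
  rw [← e, show (-1 / τ) = (-τ)⁻¹ by rw [neg_div, inv_neg, one_div]]
  change _ = τ ^ 12 * (dedekindEta (-τ)⁻¹ ^ 24 * τ ^ (-12 : ℤ))
  rw [zpow_neg]
  have : τ ^ (12 : ℤ) = τ ^ 12 := by norm_cast
  rw [this]
  field_simp

lemma etaP_T (τ : ℂ) : etaP (τ + 1) = etaP τ := by
  rw [etaP, etaP]
  congr 1; ext n
  rw [mul_add, Complex.exp_add]
  have : Complex.exp (2 * π * I * (n + 1) * 1) = 1 := by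
    rw [show 2 * π * I * ((n : ℂ) + 1) * 1 = ((n + 1 : ℕ) : ℂ) * (2 * π * I) by push_cast; ring]
    rw [Complex.exp_nat_mul_two_pi_mul_I]
  rw [this, mul_one]

lemma eta24 (τ : ℂ) : dedekindEta τ ^ 24 = Complex.exp (2 * π * I * τ) * etaP τ ^ 24 := by
  rw [eta_eq, mul_pow, ← Complex.exp_nat_mul]
  congr 2; push_cast; ring

lemma eta24_T (τ : ℂ) : dedekindEta (τ + 1) ^ 24 = dedekindEta τ ^ 24 := by
  rw [eta24, eta24, etaP_T, mul_add, Complex.exp_add, mul_one, Complex.exp_two_pi_mul_I, mul_one]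

lemma exp_pi_I_eighth : Complex.exp (π * I / 4) ^ 8 = 1 := by
  rw [show 8 = 2 * 4 by norm_num, pow_mul, exp_pi_I_half, I_pow_four]

lemma rt_pow8 (τ : ℂ) : rt τ ^ 8 = τ ^ 4 := by
  rw [show 8 = 2 * 4 by norm_num, pow_mul, rt_sq, mul_pow, Even.neg_pow (by decide), I_pow_four,
    one_mul]

lemma theta_prod8 {τ : ℂ} (h : 0 < τ.im) :
    (t2 τ * t3 τ * t4 τ) ^ 8 = 256 * dedekindEta τ ^ 24 := by
  have key := level_one_zero (F := fun τ => (t2 τ * t3 τ * t4 τ) ^ 8 / dedekindEta τ ^ 24 - 256)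
    (k := 0) (by norm_num) ?_ ?_ ?_ ?_ τ h
  · have := eta_ne h
    rw [sub_eq_zero, div_eq_iff (pow_ne_zero _ this)] at key
    exact key
  · intro τ h
    have h1 := t2_diff h
    have h2 := t3_diff h
    have h3 := t4_diff h
    have h4 := eta_diff h
    have h5 := pow_ne_zero 24 (eta_ne h)
    fun_prop (disch := assumption)
  · intro τ h
    rw [t2_add_one h, t3_add_one h, t4_add_one h, eta24_T]
    simp only [mul_pow]
    rw [exp_pi_I_eighth]
    ring
  · intro τ h
    rw [t2_S h, t3_S h, t4_S h, eta24_S h]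
    simp only [mul_pow, rt_pow8]
    have := ne_zero_of_im h
    have := eta_ne h
    field_simp
  · have : Filter.Tendsto (fun τ => (t2n τ * t3 τ * t4 τ) ^ 8 / etaP τ ^ 24 - 256) Linf
        (nhds ((2 * 1 * 1) ^ 8 / 1 ^ 24 - 256)) :=
      ((((t2n_lim.mul t3_lim).mul t4_lim).pow 8).div (etaP_lim.pow 24) (by norm_num)).sub_const _
    norm_num at this
    refine this.congr' ?_
    filter_upwards with τ
    rw [eta24, t2_eq]
    simp only [mul_pow]
    rw [← Complex.exp_nat_mul, show ((8 : ℕ) : ℂ) * (π * I * τ / 4) = 2 * π * I * τ by push_cast; ring]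
    have := Complex.exp_ne_zero (2 * π * I * τ)
    rw [show ∀ a b c d e : ℂ, a * b * c * d / (a * e) = (a * (b * c * d)) / (a * e) by intros; ring,
      mul_div_mul_left _ _ this]

lemma t2_ne {τ : ℂ} (h : 0 < τ.im) : t2 τ ≠ 0 := by
  intro h0
  have := theta_prod8 h
  rw [h0] at this
  have := eta_ne h
  simp_all
lemma t3_ne {τ : ℂ} (h : 0 < τ.im) : t3 τ ≠ 0 := by
  intro h0
  have := theta_prod8 h
  rw [h0] at this
  have := eta_ne h
  simp_all
lemma t4_ne {τ : ℂ} (h : 0 < τ.im) : t4 τ ≠ 0 := by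
  intro h0
  have := theta_prod8 h
  rw [h0] at this
  have := eta_ne h
  simp_all

lemma H_convex : Convex ℝ {z : ℂ | 0 < z.im} := convex_halfSpace_im_gt 0
lemma H_open : IsOpen {z : ℂ | 0 < z.im} := isOpen_lt continuous_const Complex.continuous_im

/-- If `f` is holomorphic on the upper half plane, `f^n = 1` there and `f → 1` then `f = 1`. -/
lemma root_one {f : ℂ → ℂ} {n : ℕ} (hn : n ≠ 0) (hd : ∀ τ : ℂ, 0 < τ.im → DifferentiableAt ℂ f τ)
    (hp : ∀ τ : ℂ, 0 < τ.im → f τ ^ n = 1) (hlim : Filter.Tendsto f Linf (nhds 1))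
    {τ : ℂ} (hτ : 0 < τ.im) : f τ = 1 := by
  have hder : ∀ z ∈ {z : ℂ | 0 < z.im}, fderivWithin ℂ f {z : ℂ | 0 < z.im} z = 0 := by
    intro z hz
    rw [fderivWithin_of_isOpen H_open hz]
    have h1 : HasDerivAt (fun w => f w ^ n) (n * f z ^ (n - 1) * deriv f z) z :=
      (hd z hz).hasDerivAt.pow n
    have h2 : HasDerivAt (fun w => f w ^ n) 0 z := by
      refine (hasDerivAt_const z (1 : ℂ)).congr_of_eventuallyEq ?_
      filter_upwards [H_open.mem_nhds hz] with w hw using hp w hw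
    have h3 := h1.unique h2
    have hf : f z ≠ 0 := by
      intro h0
      have := hp z hz
      rw [h0, zero_pow hn] at this
      exact zero_ne_one this
    have h4 : deriv f z = 0 := by
      rcases mul_eq_zero.1 h3 with h | h
      · rcases mul_eq_zero.1 h with h | h
        · exact absurd (by exact_mod_cast h) hn
        · exact absurd h (pow_ne_zero _ hf)
      · exact h
    ext
    simp [h4]
  have hc : ∀ z : ℂ, 0 < z.im → f z = f τ := fun z hz =>
    H_convex.is_const_of_fderivWithin_eq_zero (𝕜 := ℂ)
      (fun w hw => (hd w hw).differentiableWithinAt) hder hz hτ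
  have : Filter.Tendsto f Linf (nhds (f τ)) := by
    refine tendsto_const_nhds.congr' ?_
    filter_upwards [Linf_pos] with z hz using (hc z hz).symm
  exact tendsto_nhds_unique this hlim

/-- Two holomorphic functions with product zero: one of them vanishes. -/
lemma zero_or {f g : ℂ → ℂ} (hf : ∀ τ : ℂ, 0 < τ.im → DifferentiableAt ℂ f τ)
    (hg : ∀ τ : ℂ, 0 < τ.im → DifferentiableAt ℂ g τ)
    (h : ∀ τ : ℂ, 0 < τ.im → f τ * g τ = 0) :
    (∀ τ : ℂ, 0 < τ.im → f τ = 0) ∨ (∀ τ : ℂ, 0 < τ.im → g τ = 0) := by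
  have hfa : AnalyticOnNhd ℂ f {z : ℂ | 0 < z.im} :=
    DifferentiableOn.analyticOnNhd (fun z hz => (hf z hz).differentiableWithinAt) H_open
  have hga : AnalyticOnNhd ℂ g {z : ℂ | 0 < z.im} :=
    DifferentiableOn.analyticOnNhd (fun z hz => (hg z hz).differentiableWithinAt) H_open
  exact AnalyticOnNhd.eq_zero_or_eq_zero_of_mul_eq_zero hfa hga h H_convex.isPreconnected

/-- The Eisenstein series of weight four in terms of theta functions. -/
noncomputable def e4 (τ : ℂ) : ℂ := (t2 τ ^ 8 + t3 τ ^ 8 + t4 τ ^ 8) / 2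

lemma e4_T {τ : ℂ} (h : 0 < τ.im) : e4 (τ + 1) = e4 τ := by
  rw [e4, e4, t2_add_one h, t3_add_one h, t4_add_one h, mul_pow, exp_pi_I_eighth]; ring

lemma e4_S {τ : ℂ} (h : 0 < τ.im) : e4 (-1 / τ) = τ ^ 4 * e4 τ := by
  rw [e4, e4, t2_S h, t3_S h, t4_S h, mul_pow, mul_pow, mul_pow, rt_pow8]; ring

lemma e4_diff {τ : ℂ} (h : 0 < τ.im) : DifferentiableAt ℂ e4 τ := by
  have h1 := t2_diff h
  have h2 := t3_diff h
  have h3 := t4_diff h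
  rw [show e4 = fun τ => (t2 τ ^ 8 + t3 τ ^ 8 + t4 τ ^ 8) / 2 from funext fun _ => rfl]
  fun_prop

lemma t2_lim : Filter.Tendsto t2 Linf (nhds 0) := by
  have h := (q_lim.comp (Linf_mul (show (0 : ℝ) < 1 / 8 by norm_num))).mul t2n_lim
  rw [zero_mul] at h
  refine h.congr ?_
  intro τ
  rw [t2_eq]
  simp only [Function.comp]
  congr 2; push_cast; ring

lemma e4_lim : Filter.Tendsto e4 Linf (nhds 1) := by
  have := (((t2_lim.pow 8).add (t3_lim.pow 8)).add (t4_lim.pow 8)).div_const 2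
  norm_num at this
  exact this

lemma tendsto_ofComplex_Linf :
    Filter.Tendsto UpperHalfPlane.ofComplex Linf UpperHalfPlane.atImInfty :=
  UpperHalfPlane.tendsto_comap_im_ofComplex

open UpperHalfPlane ModularForm MatrixGroups EisensteinSeries in
lemma e4_eq_E {τ : ℂ} (h : 0 < τ.im) : e4 τ = E₄ (UpperHalfPlane.ofComplex τ) := by
  have key := level_one_zero (F := fun τ => e4 τ - E₄ (UpperHalfPlane.ofComplex τ))
    (k := 4) (by norm_num) ?_ ?_ ?_ ?_ τ h
  · exact sub_eq_zero.1 key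
  · intro τ h
    refine (e4_diff h).sub ?_
    have := E₄.holo'
    rw [UpperHalfPlane.mdifferentiable_iff] at this
    exact (this τ h).differentiableAt (H_open.mem_nhds h)
  · intro τ h
    have h' : 0 < (τ + 1).im := by simpa using h
    have e := congrFun (E₄.slash_action_eq' _ ⟨ModularGroup.T, rfl⟩) ⟨τ, h⟩
    change (⇑E₄ ∣[(4 : ℤ)] ModularGroup.T) _ = E₄ _ at e
    rw [SL_slash_apply, UpperHalfPlane.modular_T_smul] at e
    have h2 : denom ModularGroup.T (⟨τ, h⟩ : ℍ) = 1 := by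
      rw [ModularGroup.denom_apply]; simp [ModularGroup.T]
    rw [h2] at e
    simp only [one_zpow, mul_one] at e
    rw [e4_T h, ofComplex_apply_of_im_pos h, ofComplex_apply_of_im_pos h', ← e]
    congr 2
    ext
    simp [add_comm]
  · intro τ h
    have h' := im_S h
    have e := congrFun (E₄.slash_action_eq' _ ⟨ModularGroup.S, rfl⟩) ⟨τ, h⟩
    change (⇑E₄ ∣[(4 : ℤ)] ModularGroup.S) _ = E₄ _ at e
    rw [SL_slash_apply, UpperHalfPlane.modular_S_smul] at e
    have h2 : denom ModularGroup.S (⟨τ, h⟩ : ℍ) = τ := ModularGroup.denom_S _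
    rw [h2] at e
    have h0 := ne_zero_of_im h
    have h3 : τ ^ (4 : ℤ) = τ ^ 4 := by norm_cast
    rw [e4_S h, ofComplex_apply_of_im_pos h, ofComplex_apply_of_im_pos h', ← e, zpow_neg, h3, mul_sub]
    congr 1
    rw [mul_comm (τ ^ 4), mul_assoc, inv_mul_cancel₀ (pow_ne_zero _ h0), mul_one]
    congr 1
    ext
    simp [neg_div, inv_neg]
  · have h1 : Filter.Tendsto E₄ atImInfty (nhds 1) := by
      have hv : valueAtInfty E₄ = 1 := by
        rw [← qExpansion_coeff_zero one_pos
          (ModularFormClass.analyticAt_cuspFunction_zero E₄ one_pos one_mem_strictPeriods_SL)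
          (SlashInvariantFormClass.periodic_comp_ofComplex E₄ one_mem_strictPeriods_SL)]
        exact E_qExpansion_coeff_zero _ ⟨2, rfl⟩
      obtain ⟨c, hc, hO⟩ := ModularFormClass.exp_decay_sub_atImInfty' E₄
      rw [hv] at hO
      have h0 : Filter.Tendsto (fun τ : ℍ => Real.exp (-c * τ.im)) atImInfty (nhds 0) := by
        refine Real.tendsto_exp_atBot.comp ?_
        exact Filter.Tendsto.const_mul_atTop_of_neg (by linarith) Filter.tendsto_comap
      have := (hO.trans_tendsto h0).add_const 1
      simpa using this
    have := e4_lim.sub (h1.comp tendsto_ofComplex_Linf)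
    simpa using this

open UpperHalfPlane ModularForm MatrixGroups EisensteinSeries in
lemma e4_hasSum {τ : ℂ} (h : 0 < τ.im) :
    HasSum (fun m : ℕ => (if m = 0 then 1 else 240 * ((sigma3 m : ℤ) : ℂ)) *
      Complex.exp (2 * π * Complex.I * τ) ^ m) (e4 τ) := by
  rw [e4_eq_E h]
  have := ModularForm.hasSum_qExpansion E₄ one_pos one_mem_strictPeriods_SL (ofComplex τ)
  refine this.congr_fun ?_
  intro m
  rw [E_qExpansion_coeff _ ⟨2, rfl⟩, ofComplex_apply_of_im_pos h]
  congr 1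
  · by_cases hm : m = 0
    · simp [hm]
    · simp only [hm, if_false]
      rw [show bernoulli 4 = -1 / 30 by decide +kernel, ArithmeticFunction.sigma_apply, sigma3]
      push_cast
      norm_num
  · rw [Function.Periodic.qParam]; simp

/-- The two-variable cubic theta function. -/
noncomputable def aa (z : ℂ) : ℂ := t3 (2 * z) * t3 (6 * z) + t2 (2 * z) * t2 (6 * z)

/-- The level three relation. -/
noncomputable def rf (z : ℂ) : ℂ := e4 z + 9 * e4 (3 * z) - 10 * aa z ^ 4

lemma imc {τ : ℂ} (h : 0 < τ.im) {c : ℝ} (hc : 0 < c) : 0 < ((c : ℂ) * τ).im := by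
  simp only [mul_im, ofReal_re, ofReal_im, zero_mul, add_zero]; positivity

lemma imk {τ : ℂ} (h : 0 < τ.im) (k : ℕ) [NeZero k] {σ : ℂ} (e : σ = (k : ℂ) * τ) : 0 < σ.im :=
  e ▸ im_mul_pos h k

lemma im6 {τ : ℂ} (h : 0 < τ.im) : 0 < (6 * τ).im := im_mul_pos h 6

lemma im_half {τ : ℂ} (h : 0 < τ.im) : 0 < (τ / 2).im := by
  have := imc h (show (0 : ℝ) < 1 / 2 by norm_num)
  convert this using 2; push_cast; ring

lemma im_third {τ : ℂ} (h : 0 < τ.im) : 0 < (τ / 3).im := by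
  have := imc h (show (0 : ℝ) < 1 / 3 by norm_num)
  convert this using 2; push_cast; ring

lemma aa_T {z : ℂ} (h : 0 < z.im) : aa (z + 1) = aa z := by
  have h2 := im2 h
  have h6 := im6 h
  have h61 : 0 < (6 * z + 2).im := by simpa using h6
  have h62 : 0 < (6 * z + 2 + 2).im := by simpa using h6
  rw [aa, aa, show 2 * (z + 1) = 2 * z + 2 by ring, show 6 * (z + 1) = 6 * z + 2 + 2 + 2 by ring,
    t3_add_two h2, t2_add_two h2, t3_add_two h62, t3_add_two h61, t3_add_two h6,
    t2_add_two h62, t2_add_two h61, t2_add_two h6]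
  linear_combination (t2 (2 * z) * t2 (6 * z)) * I_pow_four

lemma aa_S {z : ℂ} (h : 0 < z.im) : aa (-1 / (3 * z)) ^ 4 = 9 * z ^ 4 * aa z ^ 4 := by
  have ha : 0 < (3 * z / 2).im := im_half (im3 h)
  have hb : 0 < (z / 2).im := im_half h
  have h0 := ne_zero_of_im h
  have e1 : 2 * (-1 / (3 * z)) = -1 / (3 * z / 2) := by field_simp
  have e2 : 6 * (-1 / (3 * z)) = -1 / (z / 2) := by field_simp; norm_num
  have key : aa (-1 / (3 * z)) = rt (3 * z / 2) * rt (z / 2) * (2 * aa z) := by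
    rw [aa, aa, e1, e2, t3_S ha, t3_S hb, t2_S ha, t2_S hb, t3_four ha, t3_four hb, t4_four ha,
      t4_four hb, show 4 * (3 * z / 2) = 6 * z by ring, show 4 * (z / 2) = 2 * z by ring]
    ring
  have r1 : rt (3 * z / 2) ^ 4 = -(3 * z / 2) ^ 2 := by
    rw [show 4 = 2 * 2 by norm_num, pow_mul, rt_sq, mul_pow, neg_sq, I_sq]; ring
  have r2 : rt (z / 2) ^ 4 = -(z / 2) ^ 2 := by
    rw [show 4 = 2 * 2 by norm_num, pow_mul, rt_sq, mul_pow, neg_sq, I_sq]; ring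
  rw [key, mul_pow, mul_pow, r1, r2]
  ring

lemma rf_T {z : ℂ} (h : 0 < z.im) : rf (z + 1) = rf z := by
  have h3 := im3 h
  have h31 : 0 < (3 * z + 1).im := by simpa using h3
  have h32 : 0 < (3 * z + 1 + 1).im := by simpa using h3
  rw [rf, rf, aa_T h, e4_T h, show 3 * (z + 1) = 3 * z + 1 + 1 + 1 by ring, e4_T h32, e4_T h31,
    e4_T h3]

lemma rf_S {z : ℂ} (h : 0 < z.im) : rf (-1 / (3 * z)) = 9 * z ^ 4 * rf z := by
  have h0 := ne_zero_of_im h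
  rw [rf, rf, aa_S h, e4_S (im3 h), show 3 * (-1 / (3 * z)) = -1 / z by field_simp, e4_S h]
  ring

lemma rf_diff {z : ℂ} (h : 0 < z.im) : DifferentiableAt ℂ rf z := by
  have c : ∀ {f : ℂ → ℂ} (k : ℂ), DifferentiableAt ℂ f (k * z) →
    DifferentiableAt ℂ (fun z => f (k * z)) z := fun k hf => hf.comp z (by fun_prop)
  have h1 := e4_diff h
  have h2 := c 3 (e4_diff (im3 h))
  have h3 := c 2 (t3_diff (im2 h))
  have h4 := c 6 (t3_diff (im6 h))
  have h5 := c 2 (t2_diff (im2 h))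
  have h6 := c 6 (t2_diff (im6 h))
  rw [show rf = fun z => e4 z + 9 * e4 (3 * z) -
    10 * (t3 (2 * z) * t3 (6 * z) + t2 (2 * z) * t2 (6 * z)) ^ 4 from funext fun _ => rfl]
  fun_prop

lemma lim_k {f : ℂ → ℂ} {l : ℂ} (hf : Filter.Tendsto f Linf (nhds l)) (k : ℕ) [NeZero k] :
    Filter.Tendsto (fun z => f (k * z)) Linf (nhds l) := by
  have : (0 : ℝ) < k := by exact_mod_cast Nat.pos_of_ne_zero (NeZero.ne k)
  have := hf.comp (Linf_mul this)
  simpa [Function.comp_def] using this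

lemma aa_lim : Filter.Tendsto aa Linf (nhds 1) := by
  have := ((lim_k t3_lim 2).mul (lim_k t3_lim 6)).add ((lim_k t2_lim 2).mul (lim_k t2_lim 6))
  norm_num at this
  exact this

lemma rf_lim : Filter.Tendsto rf Linf (nhds 0) := by
  have := (e4_lim.add ((lim_k e4_lim 3).const_mul 9)).sub ((aa_lim.pow 4).const_mul 10)
  norm_num at this
  exact this

lemma rf_bigO : (fun z => rf z / dedekindEta z ^ 24) =O[Linf] (fun _ => (1 : ℂ)) := by
  let g : ℂ → ℂ := fun z => if 0 < z.im then rf z else 0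
  have hg : ∀ᶠ z in Linf, g z = rf z := by
    filter_upwards [Linf_pos] with z hz
    simp [g, hz]
  have h1 := Function.Periodic.exp_decay_of_zero_at_inf (h := 1) (f := g) one_pos ?_ ?_ ?_
  · have h2 : (fun z : ℂ => Real.exp (-2 * π * z.im / 1)) =O[Linf]
        (fun z => dedekindEta z ^ 24) := by
      have h3 : Filter.Tendsto (fun z => etaP z ^ 24) Linf (nhds (1 ^ 24)) := etaP_lim.pow 24
      have h4 := h3.inv₀ (by norm_num)
      have h5 := (h4.isBigO_one ℝ)
      have h6 : (fun z => dedekindEta z ^ 24 * (etaP z ^ 24)⁻¹) =O[Linf]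
        (fun z => dedekindEta z ^ 24 * 1) :=
        (Asymptotics.isBigO_refl _ _).mul (h4.isBigO_one ℂ)
      simp only [mul_one] at h6
      refine Asymptotics.IsBigO.trans (Asymptotics.IsBigO.of_bound 1 ?_) h6
      filter_upwards [Linf_pos] with z hz
      rw [eta24, mul_inv_cancel_right₀ (pow_ne_zero _ (etaP_ne hz)), Complex.norm_exp]
      simp
    have h3 : rf =O[Linf] (fun z => dedekindEta z ^ 24) :=
      Asymptotics.IsBigO.trans (Asymptotics.IsBigO.congr' h1 hg (by rfl)) h2
    have h4 := h3.mul (Asymptotics.isBigO_refl (fun z => (dedekindEta z ^ 24)⁻¹) Linf)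
    refine Asymptotics.IsBigO.congr' h4 (by filter_upwards with z; rw [div_eq_mul_inv]) ?_
    filter_upwards [Linf_pos] with z hz
    rw [mul_inv_cancel₀ (pow_ne_zero _ (eta_ne hz))]
  · intro z
    simp only [g]
    have e : (z + ((1 : ℝ) : ℂ)).im = z.im := by simp
    rw [e]
    split_ifs with hz
    · rw [ofReal_one, rf_T hz]
    · rfl
  · filter_upwards [Linf_pos] with z hz
    refine (rf_diff hz).congr_of_eventuallyEq ?_
    filter_upwards [H_open.mem_nhds hz] with w hw
    exact if_pos hw
  · exact rf_lim.congr' (by filter_upwards [hg] with z hz using hz.symm)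

lemma rf_S0 {z : ℂ} (h : 0 < z.im) : rf (-1 / z) = z ^ 4 / 9 * rf (z / 3) := by
  have h0 := ne_zero_of_im h
  rw [show -1 / z = -1 / (3 * (z / 3)) by field_simp, rf_S (im_third h)]
  ring

lemma rf_S1 {z : ℂ} (h : 0 < z.im) : rf (-1 / z / 3) = 9 * z ^ 4 * rf z := by
  have h0 := ne_zero_of_im h
  rw [show -1 / z / 3 = -1 / (3 * z) by field_simp, rf_S h]

lemma rf_S2 {z : ℂ} (h : 0 < z.im) : rf ((-1 / z + 1) / 3) = z ^ 4 * rf ((z + 2) / 3) := by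
  have h0 := ne_zero_of_im h
  have hx : 0 < ((z - 1) / 3).im := im_third (by simpa using h)
  have hx0 := ne_zero_of_im hx
  have h1 : z - 1 ≠ 0 := by intro h2; rw [h2] at hx0; simp at hx0
  have hS := im_S (im3 hx)
  have hy : 0 < (-1 / (3 * ((z - 1) / 3)) - 1).im := by simpa using hS
  have e : (-1 / z + 1) / 3 = -1 / (3 * (-1 / (3 * ((z - 1) / 3)) - 1)) := by
    have : -1 / (3 * ((z - 1) / 3)) - 1 = - z / (z - 1) := by field_simp; ring
    rw [this]; field_simp; ring
  have e2 := rf_T hy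
  rw [sub_add_cancel, rf_S hx] at e2
  have e3 := rf_T hx
  rw [show (z - 1) / 3 + 1 = (z + 2) / 3 by ring] at e3
  rw [e, rf_S hy, ← e2, e3]
  field_simp; ring

lemma rf_S3 {z : ℂ} (h : 0 < z.im) : rf ((-1 / z + 2) / 3) = z ^ 4 * rf ((z + 1) / 3) := by
  have h0 := ne_zero_of_im h
  have hx : 0 < ((z + 1) / 3).im := im_third (by simpa using h)
  have hx0 := ne_zero_of_im hx
  have h1 : z + 1 ≠ 0 := by intro h2; rw [h2] at hx0; simp at hx0
  have hS := im_S (im3 hx)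
  have hy : 0 < (-1 / (3 * ((z + 1) / 3)) + 1).im := by simpa using hS
  have e : (-1 / z + 2) / 3 = -1 / (3 * (-1 / (3 * ((z + 1) / 3)) + 1)) + 1 := by
    have : -1 / (3 * ((z + 1) / 3)) + 1 = z / (z + 1) := by field_simp; ring
    rw [this]; field_simp; ring
  have e2 := rf_T hS
  rw [rf_S hx] at e2
  rw [e, rf_T (im_S (im3 hy)), rf_S hy, e2]
  field_simp; ring

lemma rf_zero {z : ℂ} (hz : 0 < z.im) : rf z = 0 := by
  have ih : ∀ {τ : ℂ} (c : ℝ), 0 < τ.im → 0 < ((τ + c) / 3).im := by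
    intro τ c h; exact im_third (by simpa using h)
  have d : ∀ (c : ℝ) {τ : ℂ}, 0 < τ.im → DifferentiableAt ℂ (fun τ => rf ((τ + c) / 3)) τ := by
    intro c τ h
    exact (rf_diff (ih c h)).comp (f := fun τ : ℂ => (τ + c) / 3) τ (by fun_prop)
  have key : ∀ τ : ℂ, 0 < τ.im →
      rf τ * (rf (τ / 3) * (rf ((τ + 1) / 3) * rf ((τ + 2) / 3))) = 0 := by
    intro τ h
    have key := level_one_zero (F := fun τ =>
      rf τ / dedekindEta τ ^ 24 * (rf (τ / 3) * (rf ((τ + 1) / 3) * rf ((τ + 2) / 3))))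
      (k := 4) (by norm_num) ?_ ?_ ?_ ?_ τ h
    · have := pow_ne_zero 24 (eta_ne h)
      rw [div_mul_eq_mul_div, div_eq_zero_iff] at key
      exact key.resolve_right this
    · intro τ h
      have h1 := rf_diff h
      have h2 := eta_diff h
      have h3 := pow_ne_zero 24 (eta_ne h)
      have h4 := d 0 h
      have h5 := d 1 h
      have h6 := d 2 h
      simp only [ofReal_zero, add_zero, ofReal_one, ofReal_ofNat] at h4 h5 h6
      exact (h1.div (h2.pow 24) h3).mul (h4.mul (h5.mul h6))
    · intro τ h
      rw [rf_T h, eta24_T, show τ + 1 + 1 = τ + 2 by ring,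
        show (τ + 1 + 2) / 3 = τ / 3 + 1 by ring, rf_T (im_third h)]
      ring
    · intro τ h
      have h3 := eta_ne h
      have h0 := ne_zero_of_im h
      rw [rf_S0 h, rf_S1 h, rf_S2 h, rf_S3 h, eta24_S h]
      have : τ ^ (4 : ℤ) = τ ^ 4 := by norm_cast
      rw [this]
      field_simp
    · rw [← Asymptotics.isLittleO_one_iff ℂ]
      have l : ∀ c : ℝ, Filter.Tendsto (fun τ => rf ((τ + c) / 3)) Linf (nhds 0) := by
        intro c
        refine (rf_lim.comp ((Linf_mul (show (0 : ℝ) < 1 / 3 by norm_num)).comp (Linf_add c))).congr ?_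
        intro τ
        simp only [Function.comp]
        congr 1; push_cast; ring
      have h4 := (l 0).mul ((l 1).mul (l 2))
      simp only [ofReal_zero, add_zero, ofReal_one, ofReal_ofNat, mul_zero] at h4
      have := rf_bigO.mul_isLittleO ((Asymptotics.isLittleO_one_iff ℂ).2 h4)
      simpa using this
  have w : ∀ c : ℝ, (∀ τ : ℂ, 0 < τ.im → rf ((τ + c) / 3) = 0) → ∀ τ : ℂ, 0 < τ.im → rf τ = 0 := by
    intro c hc τ h
    have := hc (3 * τ - c) (by simpa using h)
    rw [sub_add_cancel, mul_div_cancel_left₀ _ (by norm_num)] at this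
    exact this
  have d0 := fun τ h => d 0 (τ := τ) h
  have d1 := fun τ h => d 1 (τ := τ) h
  have d2 := fun τ h => d 2 (τ := τ) h
  have w0 := w 0
  have w1 := w 1
  have w2 := w 2
  simp only [ofReal_zero, add_zero, ofReal_one, ofReal_ofNat] at d0 d1 d2 w0 w1 w2
  rcases zero_or (fun τ h => rf_diff h)
    (fun τ h => (d0 τ h).mul ((d1 τ h).mul (d2 τ h))) key with h | h
  · exact h z hz
  rcases zero_or d0 (fun τ h => (d1 τ h).mul (d2 τ h)) h with h | h
  · exact w0 h z hz
  rcases zero_or d1 d2 h with h | h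
  · exact w1 h z hz
  · exact w2 h z hz

/-- The degree three relation in terms of theta functions. -/
lemma cubic_rel {z : ℂ} (hz : 0 < z.im) : e4 z + 9 * e4 (3 * z) =
    10 * (t3 (2 * z) * t3 (6 * z) + t2 (2 * z) * t2 (6 * z)) ^ 4 := by
  have := rf_zero hz
  rw [rf, aa] at this
  exact sub_eq_zero.1 this

lemma diff_k {f : ℂ → ℂ} (hf : ∀ {z : ℂ}, 0 < z.im → DifferentiableAt ℂ f z) (k : ℕ) [NeZero k]
    {z : ℂ} (h : 0 < z.im) : DifferentiableAt ℂ (fun z => f ((k : ℂ) * z)) z :=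
  (hf (im_mul_pos h k)).comp z (by fun_prop)

lemma not_zero_of_lim {f : ℂ → ℂ} {l : ℂ} (hl : l ≠ 0) (hf : Filter.Tendsto f Linf (nhds l)) :
    ¬ ∀ τ : ℂ, 0 < τ.im → f τ = 0 := by
  intro h
  have : Filter.Tendsto f Linf (nhds 0) := by
    refine tendsto_const_nhds.congr' ?_
    filter_upwards [Linf_pos] with z hz using (h z hz).symm
  exact hl (tendsto_nhds_unique hf this)

/-- The quartic modular equation of degree three. -/
lemma modular_eq {w : ℂ} (h : 0 < w.im) :
    (t2 (2 * w) ^ 2 * t3 (6 * w) ^ 2 - t3 (2 * w) ^ 2 * t2 (6 * w) ^ 2) ^ 2 =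
      4 * t3 (2 * w) * t2 (2 * w) * t3 (6 * w) * t2 (6 * w) *
        (t3 (2 * w) * t3 (6 * w) - t2 (2 * w) * t2 (6 * w)) ^ 2 := by
  have h2 := im2 h
  have h3 := im3 h
  have a1 := cubic_aux h2
  rw [show 3 * (2 * w) = 6 * w by ring] at a1
  have a2 := t3_mul_t4 h
  have a3 := t3_mul_t4 h3
  rw [show 2 * (3 * w) = 6 * w by ring] at a3
  have b1 := t3_sq h
  have b2 := t4_sq h
  have b3 := t3_sq h3
  have b4 := t4_sq h3
  rw [show 2 * (3 * w) = 6 * w by ring] at b3 b4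
  have c : (t3 (2 * w) ^ 2 + t2 (2 * w) ^ 2) * (t3 (2 * w) ^ 2 - t2 (2 * w) ^ 2) *
      ((t3 (6 * w) ^ 2 + t2 (6 * w) ^ 2) * (t3 (6 * w) ^ 2 - t2 (6 * w) ^ 2)) =
      (t3 (2 * w) * t3 (6 * w) - t2 (2 * w) * t2 (6 * w)) ^ 4 := by
    rw [a1, ← b1, ← b2, ← b3, ← b4, ← mul_pow, ← mul_pow, a2, a3]; ring
  linear_combination -c

/-- The product of theta constants appearing at half level. -/
noncomputable def rr (w : ℂ) : ℂ := t2 w * t2 (3 * w)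

lemma rr_sq {w : ℂ} (h : 0 < w.im) :
    rr w ^ 2 = 4 * t3 (2 * w) * t2 (2 * w) * t3 (6 * w) * t2 (6 * w) := by
  rw [rr, mul_pow, t2_sq h, t2_sq (im3 h), show 2 * (3 * w) = 6 * w by ring]; ring

/-- Sign determination. -/
lemma rr_omega {w : ℂ} (h : 0 < w.im) :
    rr w * (t3 (2 * w) * t3 (6 * w) - t2 (2 * w) * t2 (6 * w)) =
      t2 (2 * w) ^ 2 * t3 (6 * w) ^ 2 - t3 (2 * w) ^ 2 * t2 (6 * w) ^ 2 := by
  let e : ℂ → ℂ := fun w => Complex.exp (π * I * w)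
  let A : ℂ → ℂ := fun w => t2n w * t2n (3 * w) *
    (t3 (2 * w) * t3 (6 * w) - t2 (2 * w) * t2 (6 * w))
  let B : ℂ → ℂ := fun w => t2n (2 * w) ^ 2 * t3 (6 * w) ^ 2 -
    t3 (2 * w) ^ 2 * (Complex.exp (2 * π * I * w) * t2n (6 * w) ^ 2)
  have eA : ∀ w, rr w * (t3 (2 * w) * t3 (6 * w) - t2 (2 * w) * t2 (6 * w)) = e w * A w := by
    intro w
    have : rr w = e w * (t2n w * t2n (3 * w)) := by
      rw [rr, t2_eq w, t2_eq (3 * w)]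
      have : e w = Complex.exp (π * I * w / 4) * Complex.exp (π * I * (3 * w) / 4) := by
        simp only [e]; rw [← Complex.exp_add]; congr 1; ring
      rw [this]; ring
    rw [this]; simp only [A]; ring
  have eB : ∀ w, t2 (2 * w) ^ 2 * t3 (6 * w) ^ 2 - t3 (2 * w) ^ 2 * t2 (6 * w) ^ 2 = e w * B w := by
    intro w
    have h1 : t2 (2 * w) ^ 2 = e w * t2n (2 * w) ^ 2 := by
      rw [t2_eq, mul_pow, ← Complex.exp_nat_mul]; congr 2; push_cast; ring
    have h2 : t2 (6 * w) ^ 2 = e w * (Complex.exp (2 * π * I * w) * t2n (6 * w) ^ 2) := by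
      simp only [e]
      rw [t2_eq, mul_pow, ← Complex.exp_nat_mul, ← mul_assoc (Complex.exp (π * I * w)),
        ← Complex.exp_add]
      congr 2; push_cast; ring
    rw [h1, h2]; simp only [B]; ring
  have lA : Filter.Tendsto A Linf (nhds 4) := by
    have := (t2n_lim.mul (lim_k t2n_lim 3)).mul
      (((lim_k t3_lim 2).mul (lim_k t3_lim 6)).sub ((lim_k t2_lim 2).mul (lim_k t2_lim 6)))
    norm_num at this
    exact this
  have lB : Filter.Tendsto B Linf (nhds 4) := by
    have := (((lim_k t2n_lim 2).pow 2).mul ((lim_k t3_lim 6).pow 2)).sub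
      (((lim_k t3_lim 2).pow 2).mul (q_lim.mul ((lim_k t2n_lim 6).pow 2)))
    norm_num at this
    exact this
  have dA : ∀ τ : ℂ, 0 < τ.im → DifferentiableAt ℂ A τ := by
    intro τ h
    exact ((t2n_diff h).mul (diff_k t2n_diff 3 h)).mul (((diff_k t3_diff 2 h).mul
      (diff_k t3_diff 6 h)).sub ((diff_k t2_diff 2 h).mul (diff_k t2_diff 6 h)))
  have dB : ∀ τ : ℂ, 0 < τ.im → DifferentiableAt ℂ B τ := by
    intro τ h
    exact (((diff_k t2n_diff 2 h).pow 2).mul ((diff_k t3_diff 6 h).pow 2)).sub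
      (((diff_k t3_diff 2 h).pow 2).mul (DifferentiableAt.mul (by fun_prop)
        ((diff_k t2n_diff 6 h).pow 2)))
  have key : ∀ τ : ℂ, 0 < τ.im → (A τ - B τ) * (A τ + B τ) = 0 := by
    intro τ h
    have h1 := modular_eq h
    have h2 : (rr τ * (t3 (2 * τ) * t3 (6 * τ) - t2 (2 * τ) * t2 (6 * τ))) ^ 2 =
      (t2 (2 * τ) ^ 2 * t3 (6 * τ) ^ 2 - t3 (2 * τ) ^ 2 * t2 (6 * τ) ^ 2) ^ 2 := by
      rw [h1, mul_pow, rr_sq h]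
    rw [eA, eB, mul_pow (e τ), mul_pow (e τ)] at h2
    have := mul_left_cancel₀ (pow_ne_zero 2 (Complex.exp_ne_zero _ : e τ ≠ 0)) h2
    linear_combination this
  have l2 := lA.add lB
  rw [eA, eB]
  rcases zero_or (fun τ h => (dA τ h).sub (dB τ h)) (fun τ h => (dA τ h).add (dB τ h)) key with h' | h'
  · rw [sub_eq_zero.1 (h' w h)]
  · exact absurd h' (not_zero_of_lim (by norm_num) l2)

lemma ncalc {u v U V r E F : ℂ} (hu : u ≠ 0) (hv : v ≠ 0) (hU : U ≠ 0) (hV : V ≠ 0)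
    (hE : E = u ^ 8 + 14 * u ^ 4 * v ^ 4 + v ^ 8) (hF : F = U ^ 8 + 14 * U ^ 4 * V ^ 4 + V ^ 8)
    (hw : u * U - v * V ≠ 0)
    (h1 : r * (u * U - v * V) = v ^ 2 * U ^ 2 - u ^ 2 * V ^ 2) (h2 : r ^ 2 = 4 * u * v * U * V)
    (h3 : (v ^ 2 * U ^ 2 - u ^ 2 * V ^ 2) ^ 2 = 4 * u * v * U * V * (u * U - v * V) ^ 2)
    (h4 : E + 9 * F = 10 * (u * U + v * V) ^ 4) :
    (1 - (U ^ 2 * v + V * r) / (v * u ^ 2)) * ((1 + (U ^ 2 * v + V * r) / (v * u ^ 2)) *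
      (((U ^ 2 * v + V * r) / (v * u ^ 2)) ^ 2 * E - 9 * F)) = 0 := by
  have hNK : (U ^ 2 * v + V * r) * (v * r - V * u ^ 2) = 3 * u ^ 2 * U ^ 2 * v * V := by
    linear_combination r * (-h1) + (v * V + (u * U - v * V)) * h2
  have hN : U ^ 2 * v + V * r ≠ 0 := by
    intro h0
    rw [h0, zero_mul] at hNK
    have : 3 * u ^ 2 * U ^ 2 * v * V ≠ 0 := by simp [hu, hv, hU, hV]
    exact this hNK.symm
  have hP : (U ^ 2 * v + V * r) ^ 2 * (V ^ 2 * U ^ 4) * E + (v * r - V * u ^ 2) ^ 2 * (v ^ 2 * u ^ 4) * F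
      = 10 * (u * U + v * V) ^ 4 * (v ^ 2 * u ^ 4 * V ^ 2 * U ^ 4) := by
    have e1 : (U ^ 2 * v + V * r) * (u * U - v * V) =
      U ^ 2 * v * (u * U - v * V) + V * (v ^ 2 * U ^ 2 - u ^ 2 * V ^ 2) := by
      linear_combination V * h1
    have e2 : (v * r - V * u ^ 2) * (u * U - v * V) =
      v * (v ^ 2 * U ^ 2 - u ^ 2 * V ^ 2) - V * u ^ 2 * (u * U - v * V) := by
      linear_combination v * h1
    have key : ((U ^ 2 * v + V * r) * (u * U - v * V)) ^ 2 * (V ^ 2 * U ^ 4) * E +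
        ((v * r - V * u ^ 2) * (u * U - v * V)) ^ 2 * (v ^ 2 * u ^ 4) * F
      = 10 * (u * U + v * V) ^ 4 * (v ^ 2 * u ^ 4 * V ^ 2 * U ^ 4) * (u * U - v * V) ^ 2 := by
      rw [e1, e2, hE, hF]
      linear_combination (U^2*V^6*u^6*v^2 + 2*U^3*V^5*u^3*v^5 + 8*U^4*V^4*u^4*v^4 + U^4*V^4*u^8 +
        8*U^5*V^3*u^5*v^3 + U^6*V^2*u^2*v^6 + 8*U^6*V^2*u^6*v^2 + 2*U^7*V*u^7*v + U^8*u^4*v^4) * h3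
    refine mul_right_cancel₀ (pow_ne_zero 2 hw) ?_
    linear_combination key
  set N := U ^ 2 * v + V * r with hNdef
  have hK : v * r - V * u ^ 2 = 3 * u ^ 2 * U ^ 2 * v * V / N := by
    rw [eq_div_iff hN]; linear_combination hNK
  rw [hK, ← h4] at hP
  have hP' : N ^ 4 * E + 9 * (v * u ^ 2) ^ 4 * F = (E + 9 * F) * (v * u ^ 2) ^ 2 * N ^ 2 := by
    field_simp at hP
    refine mul_left_cancel₀ (mul_ne_zero (pow_ne_zero 2 hV) (pow_ne_zero 4 hU)) ?_
    linear_combination V ^ 2 * U ^ 4 * hP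
  have hvu : v * u ^ 2 ≠ 0 := mul_ne_zero hv (pow_ne_zero 2 hu)
  have : (1 - N / (v * u ^ 2)) * ((1 + N / (v * u ^ 2)) * ((N / (v * u ^ 2)) ^ 2 * E - 9 * F)) =
    -(N ^ 4 * E + 9 * (v * u ^ 2) ^ 4 * F - (E + 9 * F) * (v * u ^ 2) ^ 2 * N ^ 2) /
      (v * u ^ 2) ^ 4 := by
    field_simp
    ring
  rw [this, hP']; simp

lemma e4_half {w : ℂ} (h : 0 < w.im) : e4 w =
    t3 (2 * w) ^ 8 + 14 * t3 (2 * w) ^ 4 * t2 (2 * w) ^ 4 + t2 (2 * w) ^ 8 := by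
  rw [e4, show t2 w ^ 8 = (t2 w ^ 2) ^ 4 by ring, show t3 w ^ 8 = (t3 w ^ 2) ^ 4 by ring,
    show t4 w ^ 8 = (t4 w ^ 2) ^ 4 by ring, t2_sq h, t3_sq h, t4_sq h]
  ring

lemma omega_ne {w : ℂ} (h : 0 < w.im) :
    t3 (2 * w) * t3 (6 * w) - t2 (2 * w) * t2 (6 * w) ≠ 0 := by
  have a1 := cubic_aux (im2 h)
  rw [show 3 * (2 * w) = 6 * w by ring] at a1
  rw [a1, add_sub_cancel_left]
  exact mul_ne_zero (t4_ne (im2 h)) (t4_ne (im6 h))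

/-- The first cubic relation. -/
lemma cubic_one {w : ℂ} (h : 0 < w.im) :
    (t3 (2 * w) ^ 2 - t3 (6 * w) ^ 2) * t2 (2 * w) = t2 (6 * w) * rr w := by
  let n : ℂ → ℂ := fun w => (t3 (6 * w) ^ 2 * t2 (2 * w) + t2 (6 * w) * rr w) /
    (t2 (2 * w) * t3 (2 * w) ^ 2)
  have dr : ∀ τ : ℂ, 0 < τ.im → DifferentiableAt ℂ rr τ := fun τ h =>
    (t2_diff h).mul (diff_k t2_diff 3 h)
  have dn : ∀ τ : ℂ, 0 < τ.im → DifferentiableAt ℂ n τ := by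
    intro τ h
    exact ((((diff_k t3_diff 6 h).pow 2).mul (diff_k t2_diff 2 h)).add
      ((diff_k t2_diff 6 h).mul (dr τ h))).div ((diff_k t2_diff 2 h).mul ((diff_k t3_diff 2 h).pow 2))
      (mul_ne_zero (t2_ne (im2 h)) (pow_ne_zero 2 (t3_ne (im2 h))))
  have ln : Filter.Tendsto n Linf (nhds 1) := by
    have hq : Filter.Tendsto (fun z : ℂ => Complex.exp (π * I * z)) Linf (nhds 0) := by
      refine (q_lim.comp (Linf_mul (show (0 : ℝ) < 1 / 2 by norm_num))).congr ?_
      intro z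
      simp only [Function.comp]; congr 1; push_cast; ring
    have l1 := (((lim_k t3_lim 6).pow 2).add ((hq.mul ((lim_k t2n_lim 6).div (lim_k t2n_lim 2)
      (by norm_num))).mul (t2_lim.mul (lim_k t2_lim 3)))).div ((lim_k t3_lim 2).pow 2) (by norm_num)
    norm_num at l1
    refine l1.congr' ?_
    filter_upwards [Linf_pos] with z hz
    have h1 := t2_ne (im2 hz)
    have h2 := t3_ne (im2 hz)
    simp only [n, rr, Pi.div_apply]
    have h3 : t2 (6 * z) = t2 (2 * z) * (Complex.exp (π * I * z) * (t2n (6 * z) / t2n (2 * z))) := by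
      rw [t2_eq (2 * z)] at h1 ⊢
      rw [t2_eq (6 * z)]
      have h4 := (mul_ne_zero_iff.1 h1).2
      have : Complex.exp (π * I * (6 * z) / 4) = Complex.exp (π * I * (2 * z) / 4) *
        Complex.exp (π * I * z) := by rw [← Complex.exp_add]; congr 1; ring
      rw [this]
      field_simp
    rw [h3, show ∀ A c e B D : ℂ, (A ^ 2 * c + c * e * B) / (c * D ^ 2) =
      (c * (A ^ 2 + e * B)) / (c * D ^ 2) by intros; ring, mul_div_mul_left _ _ h1]
  have key : ∀ τ : ℂ, 0 < τ.im →
      (1 - n τ) * ((1 + n τ) * (n τ ^ 2 * e4 τ - 9 * e4 (3 * τ))) = 0 := by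
    intro τ h
    have c := cubic_rel h
    refine ncalc (t3_ne (im2 h)) (t2_ne (im2 h)) (t3_ne (im6 h)) (t2_ne (im6 h)) (e4_half h) ?_
      (omega_ne h) (rr_omega h) (rr_sq h) (modular_eq h) c
    rw [e4_half (im3 h), show 2 * (3 * τ) = 6 * τ by ring]
  have l2 := (ln.const_add 1).mul (((ln.pow 2).mul e4_lim).sub ((lim_k e4_lim 3).const_mul 9))
  rcases zero_or (fun τ h => (dn τ h).const_sub 1) (fun τ h => ((dn τ h).const_add 1).mul
    ((((dn τ h).pow 2).mul (e4_diff h)).sub ((diff_k e4_diff 3 h).const_mul 9))) key with h' | h'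
  · have h1 := t2_ne (im2 h)
    have h2 := t3_ne (im2 h)
    have := sub_eq_zero.1 (h' w h)
    simp only [n] at this
    rw [eq_div_iff (mul_ne_zero h1 (pow_ne_zero 2 h2))] at this
    linear_combination this
  · exact absurd h' (not_zero_of_lim (by norm_num) l2)

lemma cubic_two {w : ℂ} (h : 0 < w.im) :
    (t3 (2 * w) ^ 2 + 3 * t3 (6 * w) ^ 2) * t2 (6 * w) = t2 (2 * w) * rr w := by
  have h1 := cubic_one h
  have a := rr_omega h
  have b := rr_sq h
  have hv := t2_ne (im2 h)
  have hu := t3_ne (im2 h)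
  refine mul_left_cancel₀ (mul_ne_zero hv (pow_ne_zero 2 hu)) ?_
  linear_combination (t3 (2 * w) ^ 2 * t2 (6 * w) - t2 (2 * w) * rr w) * h1 + rr w * a -
    (t3 (2 * w) * t3 (6 * w)) * b

lemma param_aux {u v U V r s t : ℂ} (hu : u ≠ 0) (hv : v ≠ 0) (hV : V ≠ 0) (hr : r ≠ 0)
    (h1 : (u ^ 2 - U ^ 2) * v = V * r) (h2 : (u ^ 2 + 3 * U ^ 2) * V = v * r)
    (h3 : r ^ 2 = 4 * u * v * U * V) (hs : s ^ 2 = (u ^ 2 + v ^ 2) * (U ^ 2 + V ^ 2))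
    (ht : t ^ 2 = (u ^ 2 - v ^ 2) * (U ^ 2 - V ^ 2)) (hst : s = r + t) :
    ∃ l : ℂ, v ^ 2 + 3 * V ^ 2 ≠ 0 ∧ u = l * (v ^ 2 + 3 * V ^ 2) ∧
      U = 4 * v * V * l ^ 3 * (v ^ 2 + 3 * V ^ 2) ∧
      r = 4 * v * V * l ^ 2 * (v ^ 2 + 3 * V ^ 2) ∧
      16 * v ^ 2 * V ^ 2 * l ^ 4 * (v ^ 2 + 3 * V ^ 2) - (v ^ 2 - V ^ 2) = 0 ∧
      4 * v * V * s = 2 * v * V * r + v ^ 4 + 3 * V ^ 4 := by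
  have h4 : 4 * U ^ 2 * v * V = r * (v ^ 2 - V ^ 2) := by linear_combination v * h2 - V * h1
  have h5 : 4 * u ^ 2 * v * V = r * (v ^ 2 + 3 * V ^ 2) := by linear_combination v * h2 + 3 * V * h1
  have he : v ^ 2 + 3 * V ^ 2 ≠ 0 := by
    intro h0
    rw [h0, mul_zero] at h5
    simp [hu, hv, hV] at h5
  have a1 : u = u / (v ^ 2 + 3 * V ^ 2) * (v ^ 2 + 3 * V ^ 2) := by field_simp
  set l := u / (v ^ 2 + 3 * V ^ 2) with hl
  set e := v ^ 2 + 3 * V ^ 2 with hedef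
  have hl0 : l ≠ 0 := div_ne_zero hu he
  have a2 : r = 4 * v * V * l ^ 2 * e := by
    refine mul_right_cancel₀ he ?_
    rw [← h5, a1]; ring
  have a3 : U = 4 * v * V * l ^ 3 * e := by
    refine mul_left_cancel₀ (show 4 * v * V * u ≠ 0 by simp [hu, hv, hV]) ?_
    have : 4 * v * V * u * U = r ^ 2 := by rw [h3]; ring
    rw [this, a2, a1]; ring
  refine ⟨l, he, a1, a3, a2, ?_, ?_⟩
  · refine mul_left_cancel₀ hr ?_
    rw [a3] at h4
    have : r * (16 * v ^ 2 * V ^ 2 * l ^ 4 * e - (v ^ 2 - V ^ 2)) =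
      (4 * v * V * l ^ 2 * e) * (16 * v ^ 2 * V ^ 2 * l ^ 4 * e) - r * (v ^ 2 - V ^ 2) := by
      rw [← a2]; ring
    rw [this, ← h4]; ring
  · have h6 : r * (2 * s - r) = 2 * (u ^ 2 * V ^ 2 + v ^ 2 * U ^ 2) := by
      have : t = s - r := by rw [hst]; ring
      rw [this] at ht
      linear_combination hs - ht
    refine mul_left_cancel₀ hr ?_
    linear_combination 2 * v * V * h6 + V ^ 2 * h5 + v ^ 2 * h4

lemma param {w : ℂ} (h : 0 < w.im) :
    ∃ l : ℂ, t2 (2 * w) ^ 2 + 3 * t2 (6 * w) ^ 2 ≠ 0 ∧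
      t3 (2 * w) = l * (t2 (2 * w) ^ 2 + 3 * t2 (6 * w) ^ 2) ∧
      t3 (6 * w) = 4 * t2 (2 * w) * t2 (6 * w) * l ^ 3 * (t2 (2 * w) ^ 2 + 3 * t2 (6 * w) ^ 2) ∧
      rr w = 4 * t2 (2 * w) * t2 (6 * w) * l ^ 2 * (t2 (2 * w) ^ 2 + 3 * t2 (6 * w) ^ 2) ∧
      16 * t2 (2 * w) ^ 2 * t2 (6 * w) ^ 2 * l ^ 4 * (t2 (2 * w) ^ 2 + 3 * t2 (6 * w) ^ 2) -
        (t2 (2 * w) ^ 2 - t2 (6 * w) ^ 2) = 0 ∧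
      4 * t2 (2 * w) * t2 (6 * w) * (t3 w * t3 (3 * w)) =
        2 * t2 (2 * w) * t2 (6 * w) * rr w + t2 (2 * w) ^ 4 + 3 * t2 (6 * w) ^ 4 := by
  refine param_aux (t := t4 w * t4 (3 * w)) (t3_ne (im2 h)) (t2_ne (im2 h)) (t2_ne (im6 h))
    (mul_ne_zero (t2_ne h) (t2_ne (im3 h))) (cubic_one h) (cubic_two h) (rr_sq h) ?_ ?_ (cubic_aux h)
  · rw [mul_pow, t3_sq h, t3_sq (im3 h), show 2 * (3 * w) = 6 * w by ring]
  · rw [mul_pow, t4_sq h, t4_sq (im3 h), show 2 * (3 * w) = 6 * w by ring]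

lemma eta3 {τ : ℂ} (h : 0 < τ.im) : t2 τ * t3 τ * t4 τ = 2 * dedekindEta τ ^ 3 := by
  have key := root_one (f := fun τ => t2 τ * t3 τ * t4 τ / (2 * dedekindEta τ ^ 3)) (n := 8)
    (by norm_num) ?_ ?_ ?_ h
  · have := eta_ne h
    rw [div_eq_one_iff_eq (by simp [this])] at key
    exact key
  · intro τ h
    exact (((t2_diff h).mul (t3_diff h)).mul (t4_diff h)).div (((eta_diff h).pow 3).const_mul 2)
      (by simp [eta_ne h])
  · intro τ h
    have := eta_ne h
    rw [div_pow, theta_prod8 h, div_eq_one_iff_eq (by simp [this])]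
    ring
  · have := ((t2n_lim.mul t3_lim).mul t4_lim).div ((etaP_lim.pow 3).const_mul 2) (by norm_num)
    norm_num at this
    refine this.congr' ?_
    filter_upwards with z
    rw [t2_eq, eta_eq, mul_pow, ← Complex.exp_nat_mul,
      show ((3 : ℕ) : ℂ) * (π * I * z / 12) = π * I * z / 4 by push_cast; ring]
    simp only [Pi.div_apply]
    have := Complex.exp_ne_zero (π * I * z / 4)
    rw [show ∀ a b c d e : ℂ, a * b * c * d / (2 * (a * e)) = (a * (b * c * d)) / (a * (2 * e)) by
      intros; ring, mul_div_mul_left _ _ this]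

lemma etaA {z : ℂ} (h : 0 < z.im) : dedekindEta z ^ 2 = t4 (2 * z) * dedekindEta (2 * z) := by
  have key := root_one (f := fun z => dedekindEta z ^ 2 / (t4 (2 * z) * dedekindEta (2 * z))) (n := 3)
    (by norm_num) ?_ ?_ ?_ h
  · have := eta_ne (im2 h)
    have := t4_ne (im2 h)
    rw [div_eq_one_iff_eq (by simp [*])] at key
    exact key
  · intro τ h
    exact ((eta_diff h).pow 2).div ((diff_k t4_diff 2 h).mul (diff_k eta_diff 2 h))
      (by simp [eta_ne (im2 h), t4_ne (im2 h)])
  · intro τ h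
    have := eta_ne (im2 h)
    have := t4_ne (im2 h)
    rw [div_pow, div_eq_one_iff_eq (by simp [*])]
    have e1 := eta3 h
    have e2 := eta3 (im2 h)
    have a := t2_sq h
    have b := t3_mul_t4 h
    have c : 4 * (dedekindEta τ ^ 2) ^ 3 = 4 * (t4 (2 * τ) * dedekindEta (2 * τ)) ^ 3 := by
      calc 4 * (dedekindEta τ ^ 2) ^ 3 = (2 * dedekindEta τ ^ 3) ^ 2 := by ring
        _ = t2 τ ^ 2 * (t3 τ * t4 τ) ^ 2 := by rw [← e1]; ring
        _ = 2 * t4 (2 * τ) ^ 3 * (2 * dedekindEta (2 * τ) ^ 3) := by rw [a, b, ← e2]; ring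
        _ = _ := by ring
    exact mul_left_cancel₀ (by norm_num) c
  · have := (etaP_lim.pow 2).div ((lim_k t4_lim 2).mul (lim_k etaP_lim 2)) (by norm_num)
    norm_num at this
    refine this.congr' ?_
    filter_upwards with z
    rw [eta_eq z, eta_eq (2 * z), mul_pow, ← Complex.exp_nat_mul,
      show ((2 : ℕ) : ℂ) * (π * I * z / 12) = π * I * (2 * z) / 12 by push_cast; ring]
    simp only [Pi.div_apply]
    have := Complex.exp_ne_zero (π * I * (2 * z) / 12)
    rw [show ∀ a b c d : ℂ, a * b / (c * (a * d)) = (a * b) / (a * (c * d)) by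
      intros; ring, mul_div_mul_left _ _ this]

lemma etaB {z : ℂ} (h : 0 < z.im) :
    2 * dedekindEta (4 * z) ^ 2 = t2 (2 * z) * dedekindEta (2 * z) := by
  have key := root_one (f := fun z => 2 * dedekindEta (4 * z) ^ 2 /
    (t2 (2 * z) * dedekindEta (2 * z))) (n := 3)
    (by norm_num) ?_ ?_ ?_ h
  · have := eta_ne (im2 h)
    have := t2_ne (im2 h)
    rw [div_eq_one_iff_eq (by simp [*])] at key
    exact key
  · intro τ h
    exact (((diff_k eta_diff 4 h).pow 2).const_mul 2).div ((diff_k t2_diff 2 h).mul (diff_k eta_diff 2 h))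
      (by simp [eta_ne (im2 h), t2_ne (im2 h)])
  · intro τ h
    have := eta_ne (im2 h)
    have := t2_ne (im2 h)
    rw [div_pow, div_eq_one_iff_eq (by simp [*])]
    have e1 := eta3 (im4 h)
    have e2 := eta3 (im2 h)
    have a := t2_sq (im2 h)
    have b := t3_mul_t4 (im2 h)
    rw [show 2 * (2 * τ) = 4 * τ by ring] at a b
    have c : 2 * (2 * dedekindEta (4 * τ) ^ 2) ^ 3 = 2 * (t2 (2 * τ) * dedekindEta (2 * τ)) ^ 3 := by
      calc 2 * (2 * dedekindEta (4 * τ) ^ 2) ^ 3 = 4 * (2 * dedekindEta (4 * τ) ^ 3) ^ 2 := by ring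
        _ = (2 * t2 (4 * τ) * t3 (4 * τ)) ^ 2 * (t4 (4 * τ) ^ 2) := by rw [← e1]; ring
        _ = t2 (2 * τ) ^ 3 * (2 * dedekindEta (2 * τ) ^ 3) := by rw [← a, ← b, ← e2]; ring
        _ = _ := by ring
    exact mul_left_cancel₀ (by norm_num) c
  · have := (((lim_k etaP_lim 4).pow 2).const_mul 2).div ((lim_k t2n_lim 2).mul (lim_k etaP_lim 2))
      (by norm_num)
    norm_num at this
    refine this.congr' ?_
    filter_upwards with z
    rw [eta_eq (4 * z), eta_eq (2 * z), t2_eq (2 * z), mul_pow, ← Complex.exp_nat_mul,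
      show ((2 : ℕ) : ℂ) * (π * I * (4 * z) / 12) = π * I * (2 * z) / 4 + π * I * (2 * z) / 12 by
        push_cast; ring, Complex.exp_add]
    simp only [Pi.div_apply]
    have h1 := Complex.exp_ne_zero (π * I * (2 * z) / 4)
    have h2 := Complex.exp_ne_zero (π * I * (2 * z) / 12)
    rw [show ∀ a b c d e : ℂ, 2 * (a * b * c) / (a * d * (b * e)) =
      (a * b * (2 * c)) / (a * b * (d * e)) by
      intros; ring, mul_div_mul_left _ _ (mul_ne_zero h1 h2)]

/-- Theta function expression for `a6`. -/
noncomputable def F6 (z : ℂ) : ℂ :=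
  t3 (2 * z) * t4 (2 * z) ^ 2 * (t3 (6 * z) * t4 (6 * z) ^ 2) * (t2 (2 * z) * t2 (6 * z)) / 4

lemma F6_eq {z : ℂ} (h : 0 < z.im) : dedekindEta z ^ (2 : ℤ) * dedekindEta (2 * z) ^ (2 : ℤ) *
    dedekindEta (3 * z) ^ (2 : ℤ) * dedekindEta (6 * z) ^ (2 : ℤ) = F6 z := by
  simp only [zpow_ofNat]
  have a1 := etaA h
  have a2 := etaA (im3 h)
  have b1 := eta3 (im2 h)
  have b2 := eta3 (im6 h)
  rw [show 2 * (3 * z) = 6 * z by ring] at a2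
  rw [a1, a2, F6]
  linear_combination (-t4 (2 * z) * t4 (6 * z) / 4) * (2 * dedekindEta (6 * z) ^ 3 * b1 +
    t2 (2 * z) * t3 (2 * z) * t4 (2 * z) * b2)

/-- Theta function expression for `a8`. -/
noncomputable def F8 (z : ℂ) : ℂ := t4 (4 * z) ^ 4 * t3 (4 * z) ^ 2 * t2 (4 * z) ^ 2 / 4

lemma F8_eq {z : ℂ} (h : 0 < z.im) :
    dedekindEta (2 * z) ^ (4 : ℤ) * dedekindEta (4 * z) ^ (4 : ℤ) = F8 z := by
  simp only [zpow_ofNat]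
  have a1 := etaA (im2 h)
  have b1 := eta3 (im4 h)
  rw [show 2 * (2 * z) = 4 * z by ring] at a1
  rw [show dedekindEta (2 * z) ^ 4 = (dedekindEta (2 * z) ^ 2) ^ 2 by ring, a1, F8]
  linear_combination (-t4 (4 * z) ^ 2 / 4) * ((t2 (4 * z) * t3 (4 * z) * t4 (4 * z) + 2 * dedekindEta (4 * z) ^ 3) * b1)

lemma im8 {τ : ℂ} (h : 0 < τ.im) : 0 < (8 * τ).im := im_mul_pos h 8
lemma im12 {τ : ℂ} (h : 0 < τ.im) : 0 < (12 * τ).im := im_mul_pos h 12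

/-- Theta function expression for `a16`. -/
noncomputable def F16 (z : ℂ) : ℂ := t4 (8 * z) ^ 4 * t3 (4 * z) ^ 2 * t3 (8 * z) * t2 (8 * z) / 2

lemma F16_eq {z : ℂ} (h : 0 < z.im) :
    dedekindEta (2 * z) ^ (-4 : ℤ) * dedekindEta (4 * z) ^ (16 : ℤ) * dedekindEta (8 * z) ^ (-4 : ℤ)
      = F16 z := by
  simp only [zpow_ofNat, zpow_neg]
  have a1 := etaA (im2 h)
  have a2 := etaA (im4 h)
  have b1 := eta3 (im8 h)
  have c1 := t3_mul_t4 (im4 h)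
  rw [show 2 * (2 * z) = 4 * z by ring] at a1
  rw [show 2 * (4 * z) = 8 * z by ring] at a2 c1
  have n2 := eta_ne (im2 h)
  have n4 := eta_ne (im4 h)
  have n8 := eta_ne (im8 h)
  have m4 := t4_ne (im4 h)
  have m8 := t4_ne (im8 h)
  rw [mul_assoc, ← div_eq_mul_inv, inv_mul_eq_div, div_div, div_eq_iff (by simp [n2, n8]), F16,
    show dedekindEta (2 * z) ^ 4 = (dedekindEta (2 * z) ^ 2) ^ 2 by ring, a1,
    show dedekindEta (4 * z) ^ 16 = dedekindEta (4 * z) ^ 2 * (dedekindEta (4 * z) ^ 2) ^ 7 by ring,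
    show (t4 (4 * z) * dedekindEta (4 * z)) ^ 2 = t4 (4 * z) ^ 2 * dedekindEta (4 * z) ^ 2 by ring, a2]
  have c2 : t4 (8 * z) ^ 4 = (t3 (4 * z) * t4 (4 * z)) ^ 2 := by rw [c1]; ring
  linear_combination (-t4 (8 * z) ^ 8 * dedekindEta (8 * z) ^ 5 / 2) * b1 +
    (t4 (8 * z) ^ 5 * t3 (8 * z) * t2 (8 * z) / 2 * dedekindEta (8 * z) ^ 5) * c2

/-- Theta function expression for `a24`. -/
noncomputable def F24 (z : ℂ) : ℂ :=
  t3 (2 * z) ^ 2 * t3 (6 * z) ^ 2 * (t2 (2 * z) * t2 (6 * z)) * (t4 (4 * z) * t4 (12 * z)) / 4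

lemma F24_eq {z : ℂ} (h : 0 < z.im) :
    dedekindEta z ^ (-4 : ℤ) * dedekindEta (2 * z) ^ (11 : ℤ) * dedekindEta (3 * z) ^ (-4 : ℤ) *
          dedekindEta (4 * z) ^ (-3 : ℤ) * dedekindEta (6 * z) ^ (11 : ℤ) * dedekindEta (12 * z) ^ (-3 : ℤ)
      = F24 z := by
  simp only [zpow_ofNat, zpow_neg]
  have one : ∀ {z : ℂ}, 0 < z.im → dedekindEta (2 * z) ^ 11 / (dedekindEta z ^ 4 * dedekindEta (4 * z) ^ 3)
     = t3 (2 * z) ^ 2 * t2 (2 * z) * t4 (4 * z) / 2 := by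
    intro z h
    have a1 := etaA h
    have b1 := eta3 (im4 h)
    have b2 := eta3 (im2 h)
    have c1 := t3_mul_t4 (im2 h)
    have c2 := t2_sq (im2 h)
    rw [show 2 * (2 * z) = 4 * z by ring] at c1 c2
    have n2 := eta_ne h
    have n4 := eta_ne (im4 h)
    have n8 := eta_ne (im2 h)
    have m4 := t4_ne (im2 h)
    rw [div_eq_iff (by simp [n2, n4]), show dedekindEta z ^ 4 = (dedekindEta z ^ 2) ^ 2 by ring, a1]
    have e2 : dedekindEta (2 * z) ^ 3 = t2 (2 * z) * t3 (2 * z) * t4 (2 * z) / 2 := by rw [b2]; ring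
    have e4 : dedekindEta (4 * z) ^ 3 = t2 (4 * z) * t3 (4 * z) * t4 (4 * z) / 2 := by rw [b1]; ring
    rw [e4, show dedekindEta (2 * z) ^ 11 = (dedekindEta (2 * z) ^ 3) ^ 3 * dedekindEta (2 * z) ^ 2 by ring, e2]
    linear_combination (t2 (2 * z) * t3 (2 * z) ^ 2 * t4 (2 * z) ^ 2 * dedekindEta (2 * z) ^ 2 / 8) *
      (t2 (2 * z) ^ 2 * c1 + t4 (4 * z) ^ 2 * c2)
  have k1 := one h
  have k2 := one (im3 h)
  rw [show 2 * (3 * z) = 6 * z by ring, show 4 * (3 * z) = 12 * z by ring] at k2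
  have : F24 z = (t3 (2 * z) ^ 2 * t2 (2 * z) * t4 (4 * z) / 2) *
    (t3 (6 * z) ^ 2 * t2 (6 * z) * t4 (12 * z) / 2) := by rw [F24]; ring
  rw [this, ← k1, ← k2]
  ring

/-- Theta function expression for `a12`. -/
noncomputable def F12 (z : ℂ) : ℂ :=
  t3 (2 * z) * t3 (6 * z) * (t4 (2 * z) * t4 (6 * z)) * (t2 (2 * z) * t2 (6 * z)) *
    (t3 (4 * z) * t3 (12 * z) + t2 (4 * z) * t2 (12 * z)) / 4

lemma aa_two {z : ℂ} (h : 0 < z.im) : t3 (2 * z) ^ 4 + 3 * t3 (6 * z) ^ 4 =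
    4 * t3 (2 * z) * t3 (6 * z) * (t3 (4 * z) * t3 (12 * z) + t2 (4 * z) * t2 (12 * z)) := by
  obtain ⟨l, he, hu, hU, hr, h0, hs⟩ := param (im2 h)
  have a := t3_sq (im2 h)
  have b := t3_sq (im6 h)
  rw [show 2 * (6 * z) = 12 * z by ring] at b
  rw [show 2 * (2 * z) = 4 * z by ring] at he hu hU hr h0 hs a
  rw [show 6 * (2 * z) = 12 * z by ring] at he hu hU hr h0 hs
  rw [show 3 * (2 * z) = 6 * z by ring] at hs
  have hv := t2_ne (im4 h)
  have hV := t2_ne (im12 h)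
  rw [show t3 (2 * z) ^ 4 = (t3 (2 * z) ^ 2) ^ 2 by ring,
    show t3 (6 * z) ^ 4 = (t3 (6 * z) ^ 2) ^ 2 by ring, a, b]
  rw [hr] at hs
  refine mul_left_cancel₀ (mul_ne_zero hv hV) ?_
  rw [hu, hU]
  generalize t2 (4 * z) = v at *
  generalize t2 (12 * z) = V at *
  linear_combination ((-2)*V*l^2*v^5 + 3*V*l^4*v^7 + (-6)*V^3*l^2*v^3 + 15*V^3*l^4*v^5 +
    48*V^3*l^8*v^9 + 9*V^5*l^4*v^3 + 432*V^5*l^8*v^7 + (-27)*V^7*l^4*v + 1296*V^7*l^8*v^5 +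
    1296*V^9*l^8*v^3) * h0 -
    (l * (v ^ 2 + 3 * V ^ 2) * (4 * v * V * l ^ 3 * (v ^ 2 + 3 * V ^ 2)) + v * V) * hs

lemma a12_alg {x X y Y θ Θ r : ℂ} (hx : x ≠ 0) (hX : X ≠ 0) (hY : Y ≠ 0) (hy : y ≠ 0)
    (hθ : θ ≠ 0) (hΘ : Θ ≠ 0) (c1 : (x ^ 2 - X ^ 2) * θ = Θ * r)
    (c2 : (x ^ 2 + 3 * X ^ 2) * Θ = θ * r) (hr : r ^ 2 = 4 * x * θ * X * Θ)
    (hc : x * X = θ * Θ + y * Y) (q1 : x ^ 4 = θ ^ 4 + y ^ 4) (q2 : X ^ 4 = Θ ^ 4 + Y ^ 4) :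
    4 * x * X * θ ^ 3 = (x ^ 2 + 3 * X ^ 2) ^ 2 * Θ ∧
    4 * x * X * Y ^ 3 = (x ^ 2 + X ^ 2) ^ 2 * y ∧
    4 * x * X * (θ * Θ) = (x ^ 2 - X ^ 2) * (x ^ 2 + 3 * X ^ 2) ∧
    4 * x * X * (y * Y) = (3 * X ^ 2 - x ^ 2) * (x ^ 2 + X ^ 2) := by
  have hA : 4 * x * X * θ ^ 3 = (x ^ 2 + 3 * X ^ 2) ^ 2 * Θ := by
    refine mul_right_cancel₀ hΘ ?_
    linear_combination -θ ^ 2 * hr - ((x ^ 2 + 3 * X ^ 2) * Θ + θ * r) * c2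
  have hB : 4 * x * X * Θ ^ 3 = (x ^ 2 - X ^ 2) ^ 2 * θ := by
    refine mul_right_cancel₀ hθ ?_
    linear_combination -Θ ^ 2 * hr - ((x ^ 2 - X ^ 2) * θ + Θ * r) * c1
  have hE : 4 * x * X * (θ * Θ) = (x ^ 2 - X ^ 2) * (x ^ 2 + 3 * X ^ 2) := by
    refine mul_right_cancel₀ (mul_ne_zero hθ hΘ) ?_
    linear_combination -(x ^ 2 - X ^ 2) * θ * c2 - θ * r * c1 - θ * Θ * hr
  have hG : 4 * x * X * (y * Y) = (3 * X ^ 2 - x ^ 2) * (x ^ 2 + X ^ 2) := by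
    linear_combination -4 * x * X * hc - hE
  refine ⟨hA, ?_, hE, hG⟩
  refine mul_right_cancel₀ (mul_ne_zero (mul_ne_zero hx hX) hY) ?_
  have k : 16 * x ^ 2 * X ^ 2 * Θ ^ 4 = (x ^ 2 - X ^ 2) ^ 3 * (x ^ 2 + 3 * X ^ 2) := by
    linear_combination 4 * x * X * Θ * hB + (x ^ 2 - X ^ 2) ^ 2 * hE
  linear_combination (-4 * x ^ 2 * X ^ 2) * q2 - k / 4 - (x ^ 2 + X ^ 2) ^ 2 / 4 * hG

lemma eta_e (z : ℂ) (k : ℕ) :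
    dedekindEta (k * z) = Complex.exp (π * I * z / 12) ^ k * etaP (k * z) := by
  rw [eta_eq, ← Complex.exp_nat_mul]; congr 2; ring

lemma t2_e (z : ℂ) (k : ℕ) : t2 (2 * k * z) = Complex.exp (π * I * z / 12) ^ (6 * k) * t2n (2 * k * z) := by
  rw [t2_eq, ← Complex.exp_nat_mul]; congr 2; push_cast; ring

lemma a12_facts {z : ℂ} (h : 0 < z.im) :
    4 * t3 (2 * z) * t3 (6 * z) * t2 (2 * z) ^ 3 =
      (t3 (2 * z) ^ 2 + 3 * t3 (6 * z) ^ 2) ^ 2 * t2 (6 * z) ∧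
    4 * t3 (2 * z) * t3 (6 * z) * t4 (6 * z) ^ 3 =
      (t3 (2 * z) ^ 2 + t3 (6 * z) ^ 2) ^ 2 * t4 (2 * z) ∧
    4 * t3 (2 * z) * t3 (6 * z) * (t2 (2 * z) * t2 (6 * z)) =
      (t3 (2 * z) ^ 2 - t3 (6 * z) ^ 2) * (t3 (2 * z) ^ 2 + 3 * t3 (6 * z) ^ 2) ∧
    4 * t3 (2 * z) * t3 (6 * z) * (t4 (2 * z) * t4 (6 * z)) =
      (3 * t3 (6 * z) ^ 2 - t3 (2 * z) ^ 2) * (t3 (2 * z) ^ 2 + t3 (6 * z) ^ 2) := by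
  have c := cubic_aux (im2 h)
  rw [show 3 * (2 * z) = 6 * z by ring] at c
  exact a12_alg (t3_ne (im2 h)) (t3_ne (im6 h)) (t4_ne (im6 h)) (t4_ne (im2 h)) (t2_ne (im2 h))
    (t2_ne (im6 h)) (cubic_one h) (cubic_two h) (rr_sq h) c (t_quartic (im2 h)) (t_quartic (im6 h))

/-- The first eta quotient of `a12`. -/
noncomputable def h12 (z : ℂ) : ℂ := dedekindEta (4 * z) ^ 3 * dedekindEta (3 * z) ^ 3 *
  (dedekindEta (2 * z) ^ 2 * dedekindEta (6 * z) ^ 2) / (dedekindEta z * dedekindEta (12 * z))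

/-- Its theta expression. -/
noncomputable def H12 (z : ℂ) : ℂ := (t3 (2 * z) ^ 2 + 3 * t3 (6 * z) ^ 2) *
  (t3 (2 * z) ^ 2 + t3 (6 * z) ^ 2) * (t2 (2 * z) * t2 (6 * z)) * (t4 (2 * z) * t4 (6 * z)) / 32

lemma H12_ne {z : ℂ} (h : 0 < z.im) : H12 z ≠ 0 := by
  obtain ⟨hA, hC, hE, hG⟩ := a12_facts h
  have n1 := t3_ne (im2 h)
  have n2 := t3_ne (im6 h)
  have n3 := t2_ne (im2 h)
  have n4 := t4_ne (im6 h)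
  have m1 : t3 (2 * z) ^ 2 + 3 * t3 (6 * z) ^ 2 ≠ 0 := by
    intro h0; rw [h0] at hA; simp [n1, n2, n3] at hA
  have m2 : t3 (2 * z) ^ 2 + t3 (6 * z) ^ 2 ≠ 0 := by
    intro h0; rw [h0] at hC; simp [n1, n2, n4] at hC
  rw [H12]
  simp [m1, m2, n3, n4, t2_ne (im6 h), t4_ne (im2 h)]

lemma eta_rels {z : ℂ} (h : 0 < z.im) :
    dedekindEta z ^ 2 = t4 (2 * z) * dedekindEta (2 * z) ∧
    dedekindEta (3 * z) ^ 2 = t4 (6 * z) * dedekindEta (6 * z) ∧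
    dedekindEta (4 * z) ^ 2 = t2 (2 * z) * dedekindEta (2 * z) / 2 ∧
    dedekindEta (12 * z) ^ 2 = t2 (6 * z) * dedekindEta (6 * z) / 2 ∧
    dedekindEta (2 * z) ^ 6 = (t2 (2 * z) * t3 (2 * z) * t4 (2 * z) / 2) ^ 2 ∧
    dedekindEta (6 * z) ^ 6 = (t2 (6 * z) * t3 (6 * z) * t4 (6 * z) / 2) ^ 2 := by
  have a1 := etaA h
  have a2 := etaA (im3 h)
  have a3 := etaB h
  have a4 := etaB (im3 h)
  rw [show 2 * (3 * z) = 6 * z by ring] at a2 a4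
  rw [show 4 * (3 * z) = 12 * z by ring] at a4
  have b1 := eta3 (im2 h)
  have b2 := eta3 (im6 h)
  refine ⟨a1, a2, by rw [← a3]; ring, by rw [← a4]; ring, by rw [b1]; ring, by rw [b2]; ring⟩

lemma h12_sq {z : ℂ} (h : 0 < z.im) : h12 z ^ 2 = H12 z ^ 2 := by
  obtain ⟨hA, hC, hE, hG⟩ := a12_facts h
  obtain ⟨a1, a3, a4, a12, b2, b6⟩ := eta_rels h
  have n1 := eta_ne h
  have n2 := eta_ne (im12 h)
  rw [h12, div_pow, div_eq_iff (by simp [n1, n2])]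
  rw [show ∀ a b c d : ℂ, (a ^ 3 * b ^ 3 * (c ^ 2 * d ^ 2)) ^ 2 =
    (a ^ 2) ^ 3 * (b ^ 2) ^ 3 * (c ^ 2 * d ^ 2) ^ 2 by intros; ring, mul_pow (dedekindEta z),
    a1, a3, a4, a12, H12]
  have e : ∀ a b c d e2 e6 f g : ℂ, (a * e2 / 2) ^ 3 * (b * e6) ^ 3 * (e2 ^ 2 * e6 ^ 2) ^ 2 =
    e2 * e6 * (a ^ 3 * b ^ 3 / 8 * e2 ^ 6 * e6 ^ 6) := by intros; ring
  rw [e _ _ 0 0 _ _ 0 0, b2, b6]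
  have s : ((t3 (2 * z) ^ 2 + 3 * t3 (6 * z) ^ 2) *
    (t3 (2 * z) ^ 2 + t3 (6 * z) ^ 2) * (t2 (2 * z) * t2 (6 * z)) * (t4 (2 * z) * t4 (6 * z)) / 32) ^ 2
    = ((t3 (2 * z) ^ 2 + 3 * t3 (6 * z) ^ 2) ^ 2 * t2 (6 * z)) *
    ((t3 (2 * z) ^ 2 + t3 (6 * z) ^ 2) ^ 2 * t4 (2 * z)) * (t2 (2 * z) ^ 2 * t2 (6 * z)) *
      (t4 (2 * z) * t4 (6 * z) ^ 2) / 1024 := by ring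
  rw [s, ← hA, ← hC]
  ring

lemma E_cancel (E : ℂ) (hE : E ≠ 0) (a b c d e f P k l m : ℂ) : (E ^ 4 * a) ^ 3 * (E ^ 3 * b) ^ 3 *
      ((E ^ 2 * c) ^ 2 * (E ^ 6 * d) ^ 2) / (E * e * (E ^ 12 * f)) /
      (P * (E ^ 6 * k * (E ^ 18 * l)) * m / 32) =
      a ^ 3 * b ^ 3 * (c ^ 2 * d ^ 2) / (e * f) / (P * (k * l) * m / 32) := by
  rw [show (E ^ 4 * a) ^ 3 * (E ^ 3 * b) ^ 3 * ((E ^ 2 * c) ^ 2 * (E ^ 6 * d) ^ 2) =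
    E ^ 13 * (E ^ 24 * (a ^ 3 * b ^ 3 * (c ^ 2 * d ^ 2))) by ring,
    show E * e * (E ^ 12 * f) = E ^ 13 * (e * f) by ring,
    mul_div_mul_left _ _ (pow_ne_zero 13 hE), mul_div_assoc,
    show P * (E ^ 6 * k * (E ^ 18 * l)) * m / 32 = E ^ 24 * (P * (k * l) * m / 32) by ring,
    mul_div_mul_left _ _ (pow_ne_zero 24 hE)]

lemma h12_eq {z : ℂ} (h : 0 < z.im) : h12 z = H12 z := by
  have key := root_one (f := fun z => h12 z / H12 z) (n := 2) (by norm_num) ?_ ?_ ?_ h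
  · exact (div_eq_one_iff_eq (H12_ne h)).1 key
  · intro z h
    refine DifferentiableAt.div ?_ ?_ (H12_ne h)
    · exact ((((diff_k eta_diff 4 h).pow 3).mul ((diff_k eta_diff 3 h).pow 3)).mul
        (((diff_k eta_diff 2 h).pow 2).mul ((diff_k eta_diff 6 h).pow 2))).div
        ((eta_diff h).mul (diff_k eta_diff 12 h)) (mul_ne_zero (eta_ne h) (eta_ne (im12 h)))
    · exact ((((((diff_k t3_diff 2 h).pow 2).add (((diff_k t3_diff 6 h).pow 2).const_mul 3)).mul
        (((diff_k t3_diff 2 h).pow 2).add ((diff_k t3_diff 6 h).pow 2))).mul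
        ((diff_k t2_diff 2 h).mul (diff_k t2_diff 6 h))).mul
        ((diff_k t4_diff 2 h).mul (diff_k t4_diff 6 h))).div_const 32
  · intro z h
    rw [div_pow, h12_sq h, div_self (pow_ne_zero 2 (H12_ne h))]
  · have l1 := ((((lim_k etaP_lim 4).pow 3).mul ((lim_k etaP_lim 3).pow 3)).mul
        (((lim_k etaP_lim 2).pow 2).mul ((lim_k etaP_lim 6).pow 2))).div
        ((etaP_lim).mul (lim_k etaP_lim 12)) (by norm_num)
    have l2 := ((((((lim_k t3_lim 2).pow 2).add (((lim_k t3_lim 6).pow 2).const_mul 3)).mul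
        (((lim_k t3_lim 2).pow 2).add ((lim_k t3_lim 6).pow 2))).mul
        ((lim_k t2n_lim 2).mul (lim_k t2n_lim 6))).mul
        ((lim_k t4_lim 2).mul (lim_k t4_lim 6))).div_const 32
    have l3 := l1.div l2 (by norm_num)
    norm_num at l3
    refine l3.congr' ?_
    filter_upwards [Linf_pos] with z hz
    have e1 := eta_e z 1
    have e2 := eta_e z 2
    have e3 := eta_e z 3
    have e4 := eta_e z 4
    have e6 := eta_e z 6
    have e12 := eta_e z 12
    have f1 := t2_e z 1
    have f3 := t2_e z 3
    norm_num at e1 e2 e3 e4 e6 e12 f1 f3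
    rw [h12, H12, e1, e2, e3, e4, e6, e12, f1, f3]
    simp only [Pi.div_apply]
    have hE := Complex.exp_ne_zero (π * I * z / 12)
    generalize Complex.exp (π * I * z / 12) = E at *
    exact (E_cancel E hE _ _ _ _ _ _ _ _ _ _).symm

lemma F12_eq {z : ℂ} (h : 0 < z.im) :
    dedekindEta z ^ (-1 : ℤ) * dedekindEta (2 * z) ^ (2 : ℤ) * dedekindEta (3 * z) ^ (3 : ℤ) *
        dedekindEta (4 * z) ^ (3 : ℤ) * dedekindEta (6 * z) ^ (2 : ℤ) * dedekindEta (12 * z) ^ (-1 : ℤ) -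
      dedekindEta z ^ (3 : ℤ) * dedekindEta (2 * z) ^ (2 : ℤ) * dedekindEta (3 * z) ^ (-1 : ℤ) *
        dedekindEta (4 * z) ^ (-1 : ℤ) * dedekindEta (6 * z) ^ (2 : ℤ) * dedekindEta (12 * z) ^ (3 : ℤ)
      = F12 z := by
  simp only [zpow_ofNat, zpow_neg, pow_one]
  obtain ⟨hA, hC, hE, hG⟩ := a12_facts h
  obtain ⟨a1, a3, a4, a12, b2, b6⟩ := eta_rels h
  have k1 : (dedekindEta z)⁻¹ * dedekindEta (2 * z) ^ 2 * dedekindEta (3 * z) ^ 3 *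
    dedekindEta (4 * z) ^ 3 * dedekindEta (6 * z) ^ 2 * (dedekindEta (12 * z))⁻¹ = H12 z := by
    rw [← h12_eq h, h12, div_eq_mul_inv, mul_inv]; ring
  have k2 : dedekindEta z ^ 3 * dedekindEta (2 * z) ^ 2 * (dedekindEta (3 * z))⁻¹ *
    (dedekindEta (4 * z))⁻¹ * dedekindEta (6 * z) ^ 2 * dedekindEta (12 * z) ^ 3 =
     (3 * t3 (6 * z) ^ 2 - t3 (2 * z) ^ 2) * (t3 (2 * z) ^ 2 - t3 (6 * z) ^ 2) *
      (t2 (2 * z) * t2 (6 * z)) * (t4 (2 * z) * t4 (6 * z)) / 32 := by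
    refine mul_left_cancel₀ (H12_ne h) ?_
    have n1 := eta_ne h
    have n3 := eta_ne (im3 h)
    have n4 := eta_ne (im4 h)
    have n12 := eta_ne (im12 h)
    calc _ = dedekindEta z ^ 2 * dedekindEta (3 * z) ^ 2 * dedekindEta (4 * z) ^ 2 *
          dedekindEta (12 * z) ^ 2 * (dedekindEta (2 * z) ^ 4 * dedekindEta (6 * z) ^ 4) := by
          rw [← k1]; field_simp
      _ = t2 (2 * z) * t2 (6 * z) * (t4 (2 * z) * t4 (6 * z)) / 4 *
          (dedekindEta (2 * z) ^ 6 * dedekindEta (6 * z) ^ 6) := by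
          rw [a1, a3, a4, a12]; ring
      _ = (4 * t3 (2 * z) * t3 (6 * z) * (t2 (2 * z) * t2 (6 * z))) *
          (4 * t3 (2 * z) * t3 (6 * z) * (t4 (2 * z) * t4 (6 * z))) *
          (t2 (2 * z) * t2 (6 * z) * (t4 (2 * z) * t4 (6 * z))) ^ 2 / 1024 := by
          rw [b2, b6]; ring
      _ = _ := by rw [hE, hG, H12]; ring
  rw [k1, k2, H12, F12]
  linear_combination (t2 (2 * z) * t2 (6 * z)) * (t4 (2 * z) * t4 (6 * z)) / 16 * aa_two h

lemma e4_1 {z : ℂ} (h : 0 < z.im) : e4 z = 16 * (t3 (8 * z) + t2 (8 * z)) ^ 8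
    - 16 * (t3 (8 * z) + t2 (8 * z)) ^ 4 * (t3 (8 * z) - t2 (8 * z)) ^ 4
    + (t3 (8 * z) - t2 (8 * z)) ^ 8 := by
  have a := t3_four (im2 h)
  have b := t4_four (im2 h)
  have c := t_quartic (im2 h)
  rw [show 4 * (2 * z) = 8 * z by ring] at a b
  rw [← a, ← b, e4_half h]
  linear_combination (-14 * t3 (2 * z) ^ 4 - (t2 (2 * z) ^ 4 + (t3 (2 * z) ^ 4 - t4 (2 * z) ^ 4))) * c

lemma e4_4 {z : ℂ} (h : 0 < z.im) : e4 (4 * z) = t3 (8 * z) ^ 8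
    + 14 * t3 (8 * z) ^ 4 * t2 (8 * z) ^ 4 + t2 (8 * z) ^ 8 := by
  have := e4_half (im4 h)
  rwa [show 2 * (4 * z) = 8 * z by ring] at this

lemma e4_8 {z : ℂ} (h : 0 < z.im) : e4 (8 * z) = t3 (8 * z) ^ 8
    - t3 (8 * z) ^ 4 * t2 (8 * z) ^ 4 + t2 (8 * z) ^ 8 := by
  have c := t_quartic (im8 h)
  rw [e4]
  linear_combination (-(t4 (8 * z) ^ 4 + (t3 (8 * z) ^ 4 - t2 (8 * z) ^ 4)) / 2) * c

lemma e4_16 {z : ℂ} (h : 0 < z.im) : e4 (16 * z) = t3 (8 * z) ^ 8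
    - t3 (8 * z) ^ 4 * t2 (8 * z) ^ 4 + t2 (8 * z) ^ 8 / 16 := by
  have c := t_quartic (im8 h)
  have a := t3_sq (im8 h)
  have b := t4_sq (im8 h)
  have d := t3_mul_t4 (im8 h)
  rw [show 2 * (8 * z) = 16 * z by ring] at a b d
  have a' : t3 (16 * z) ^ 2 = (t3 (8 * z) ^ 2 + t4 (8 * z) ^ 2) / 2 := by rw [a, b]; ring
  have b' : t2 (16 * z) ^ 2 = (t3 (8 * z) ^ 2 - t4 (8 * z) ^ 2) / 2 := by rw [a, b]; ring
  rw [e4, show t2 (16 * z) ^ 8 = (t2 (16 * z) ^ 2) ^ 4 by ring,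
    show t3 (16 * z) ^ 8 = (t3 (16 * z) ^ 2) ^ 4 by ring,
    show t4 (16 * z) ^ 8 = (t4 (16 * z) ^ 2) ^ 4 by ring, a', b', ← d]
  have c' : t2 (8 * z) ^ 4 = t3 (8 * z) ^ 4 - t4 (8 * z) ^ 4 := by rw [c]; ring
  rw [show t2 (8 * z) ^ 8 = (t2 (8 * z) ^ 4) ^ 2 by ring, c']
  ring

/-- Product of the two `θ₃`. -/
noncomputable def ss (z : ℂ) : ℂ := t3 (4 * z) * t3 (12 * z)

/-- Product of the two `θ₂`. -/
noncomputable def qq (z : ℂ) : ℂ := t2 (4 * z) * t2 (12 * z)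

lemma im24 {z : ℂ} (h : 0 < z.im) : 0 < (24 * z).im := by
  have := im8 (im3 h)
  rwa [show 8 * (3 * z) = 24 * z by ring] at this

lemma ss_sub {z : ℂ} (h : 0 < z.im) : t4 (4 * z) * t4 (12 * z) = ss z - qq z := by
  have := cubic_aux (im4 h)
  rw [show 3 * (4 * z) = 12 * z by ring] at this
  rw [ss, qq, this]; ring

lemma base_rels {z : ℂ} (h : 0 < z.im) :
    t3 (2 * z) = t3 (8 * z) + t2 (8 * z) ∧ t4 (2 * z) = t3 (8 * z) - t2 (8 * z) ∧
    t3 (6 * z) = t3 (24 * z) + t2 (24 * z) ∧ t4 (6 * z) = t3 (24 * z) - t2 (24 * z) ∧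
    t2 (2 * z) * t2 (6 * z) = 2 * (t3 (8 * z) * t2 (24 * z) + t2 (8 * z) * t3 (24 * z)) ∧
    t4 (8 * z) * t4 (24 * z) = t3 (8 * z) * t3 (24 * z) - t2 (8 * z) * t2 (24 * z) := by
  have a := t3_four (im2 h)
  have b := t4_four (im2 h)
  have a' := t3_four (im6 h)
  have b' := t4_four (im6 h)
  have c := cubic_aux (im2 h)
  have d := cubic_aux (im8 h)
  rw [show 4 * (2 * z) = 8 * z by ring] at a b
  rw [show 4 * (6 * z) = 24 * z by ring] at a' b'
  rw [show 3 * (2 * z) = 6 * z by ring] at c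
  rw [show 3 * (8 * z) = 24 * z by ring] at d
  refine ⟨a, b, a', b', ?_, ?_⟩
  · rw [a, b, a', b'] at c
    linear_combination -c
  · linear_combination -d

lemma F6_1 {z : ℂ} (h : 0 < z.im) : F6 z = (t3 (8 * z) + t2 (8 * z)) * (t3 (8 * z) - t2 (8 * z)) ^ 2 *
    ((t3 (24 * z) + t2 (24 * z)) * (t3 (24 * z) - t2 (24 * z)) ^ 2) *
    (t3 (8 * z) * t2 (24 * z) + t2 (8 * z) * t3 (24 * z)) / 2 := by
  obtain ⟨a, b, c, d, e, -⟩ := base_rels h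
  rw [F6, a, b, c, d, e]; ring

lemma F12_1 {z : ℂ} (h : 0 < z.im) : F12 z = (t3 (8 * z) + t2 (8 * z)) * (t3 (8 * z) - t2 (8 * z)) *
    ((t3 (24 * z) + t2 (24 * z)) * (t3 (24 * z) - t2 (24 * z))) *
    (t3 (8 * z) * t2 (24 * z) + t2 (8 * z) * t3 (24 * z)) * (ss z + qq z) / 2 := by
  obtain ⟨a, b, c, d, e, -⟩ := base_rels h
  rw [F12, a, b, c, d, e, ss, qq]; ring

lemma F24_1 {z : ℂ} (h : 0 < z.im) : F24 z = (t3 (8 * z) + t2 (8 * z)) ^ 2 *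
    (t3 (24 * z) + t2 (24 * z)) ^ 2 *
    (t3 (8 * z) * t2 (24 * z) + t2 (8 * z) * t3 (24 * z)) * (ss z - qq z) / 2 := by
  obtain ⟨a, b, c, d, e, -⟩ := base_rels h
  rw [F24, a, c, e, ss_sub h]; ring

lemma F6_2 {z : ℂ} (h : 0 < z.im) : F6 (2 * z) = ss z * (ss z - qq z) ^ 2 * qq z / 4 := by
  rw [← ss_sub h, F6, ss, qq, show 2 * (2 * z) = 4 * z by ring, show 6 * (2 * z) = 12 * z by ring]; ring

lemma sr {z : ℂ} (h : 0 < z.im) :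
    ss z * qq z = (t3 (8 * z) * t2 (24 * z) + t2 (8 * z) * t3 (24 * z)) ^ 2 := by
  obtain ⟨-, -, -, -, e, -⟩ := base_rels h
  have a := t2_sq (im2 h)
  have b := t2_sq (im6 h)
  rw [show 2 * (2 * z) = 4 * z by ring] at a
  rw [show 2 * (6 * z) = 12 * z by ring] at b
  rw [ss, qq]
  have : (t2 (2 * z) * t2 (6 * z)) ^ 2 = 4 * (t3 (4 * z) * t3 (12 * z) * (t2 (4 * z) * t2 (12 * z))) := by
    rw [mul_pow, a, b]; ring
  rw [e] at this
  linear_combination (-1/4) * this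

lemma tt {z : ℂ} (h : 0 < z.im) :
    (ss z - qq z) ^ 2 = (t3 (8 * z) + t2 (8 * z)) * (t3 (8 * z) - t2 (8 * z)) *
    ((t3 (24 * z) + t2 (24 * z)) * (t3 (24 * z) - t2 (24 * z))) := by
  obtain ⟨x, y, X, Y, -, -⟩ := base_rels h
  have c := t3_mul_t4 (im2 h)
  have d := t3_mul_t4 (im6 h)
  rw [show 2 * (2 * z) = 4 * z by ring] at c
  rw [show 2 * (6 * z) = 12 * z by ring] at d
  rw [← x, ← y, ← X, ← Y, ← ss_sub h, c, d]; ring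

lemma F6_2' {z : ℂ} (h : 0 < z.im) : F6 (2 * z) =
    (t3 (8 * z) + t2 (8 * z)) * (t3 (8 * z) - t2 (8 * z)) *
    ((t3 (24 * z) + t2 (24 * z)) * (t3 (24 * z) - t2 (24 * z))) *
    (t3 (8 * z) * t2 (24 * z) + t2 (8 * z) * t3 (24 * z)) ^ 2 / 4 := by
  rw [F6_2 h, ← sr h, ← tt h]; ring

lemma F6_4 {z : ℂ} (h : 0 < z.im) : F6 (4 * z) =
    (t3 (8 * z) * t3 (24 * z) - t2 (8 * z) * t2 (24 * z)) ^ 2 *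
      (t3 (8 * z) * t2 (8 * z) * (t3 (24 * z) * t2 (24 * z))) / 4 := by
  obtain ⟨-, -, -, -, -, e⟩ := base_rels h
  rw [← e, F6, show 2 * (4 * z) = 8 * z by ring, show 6 * (4 * z) = 24 * z by ring]; ring

lemma F6_8 {z : ℂ} (h : 0 < z.im) : F6 (8 * z) =
    (t3 (8 * z) * t3 (24 * z)) * (t3 (8 * z) * t3 (24 * z) - t2 (8 * z) * t2 (24 * z)) *
      (t2 (8 * z) * t2 (24 * z)) ^ 2 / 16 := by
  obtain ⟨-, -, -, -, -, e⟩ := base_rels h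
  have a := t3_mul_t4 (im8 h)
  have b := t3_mul_t4 (im24 h)
  have c := t2_sq (im8 h)
  have d := t2_sq (im24 h)
  rw [← e, F6, show 2 * (8 * z) = 16 * z by ring, show 6 * (8 * z) = 48 * z by ring]
  rw [show 2 * (8 * z) = 16 * z by ring] at a c
  rw [show 2 * (24 * z) = 48 * z by ring] at b d
  calc _ = t4 (16 * z) ^ 2 * t4 (48 * z) ^ 2 * (2 * t2 (16 * z) * t3 (16 * z)) *
        (2 * t2 (48 * z) * t3 (48 * z)) / 16 := by ring
    _ = _ := by rw [← a, ← b, ← c, ← d]; ring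

lemma F8_2 {z : ℂ} (h : 0 < z.im) : F8 (2 * z) =
    (t3 (8 * z) ^ 4 - t2 (8 * z) ^ 4) * t3 (8 * z) ^ 2 * t2 (8 * z) ^ 2 / 4 := by
  have c := t_quartic (im8 h)
  rw [F8, show 4 * (2 * z) = 8 * z by ring, c]; ring

lemma F12_4 {z : ℂ} (h : 0 < z.im) : F12 (4 * z) =
    (t3 (8 * z) * t3 (24 * z)) * (t3 (8 * z) * t3 (24 * z) - t2 (8 * z) * t2 (24 * z)) *
      (t2 (8 * z) * t2 (24 * z)) * (2 * ss z - qq z) / 8 := by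
  obtain ⟨-, -, -, -, -, e⟩ := base_rels h
  have a := t3_four (im4 h)
  have b := t4_four (im4 h)
  have a' := t3_four (im12 h)
  have b' := t4_four (im12 h)
  have t := ss_sub h
  rw [show 4 * (4 * z) = 16 * z by ring] at a b
  rw [show 4 * (12 * z) = 48 * z by ring] at a' b'
  rw [b, b'] at t
  rw [← e, F12, show 2 * (4 * z) = 8 * z by ring, show 6 * (4 * z) = 24 * z by ring,
    show 4 * (4 * z) = 16 * z by ring, show 12 * (4 * z) = 48 * z by ring]
  have k : ss z = (t3 (16 * z) + t2 (16 * z)) * (t3 (48 * z) + t2 (48 * z)) := by rw [ss, a, a']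
  rw [show 2 * ss z - qq z = 2 * (t3 (16 * z) * t3 (48 * z) + t2 (16 * z) * t2 (48 * z)) by
    linear_combination -t + k]
  ring

lemma F16_1 {z : ℂ} (h : 0 < z.im) : F16 z =
    (t3 (8 * z) ^ 2 + t2 (8 * z) ^ 2) ^ 2 * (t3 (8 * z) * t2 (8 * z)) *
      (t3 (8 * z) ^ 2 - t2 (8 * z) ^ 2) / 2 := by
  have c := t_quartic (im8 h)
  have a := t3_sq (im4 h)
  rw [show 2 * (4 * z) = 8 * z by ring] at a
  rw [F16, a]
  linear_combination (-(t3 (8 * z) ^ 2 + t2 (8 * z) ^ 2) * t3 (8 * z) * t2 (8 * z) / 2) * c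

lemma F24_2 {z : ℂ} (h : 0 < z.im) : F24 (2 * z) = ss z ^ 2 * qq z *
    (t3 (8 * z) * t3 (24 * z) - t2 (8 * z) * t2 (24 * z)) / 4 := by
  obtain ⟨-, -, -, -, -, e⟩ := base_rels h
  rw [← e, F24, show 2 * (2 * z) = 4 * z by ring, show 6 * (2 * z) = 12 * z by ring,
    show 4 * (2 * z) = 8 * z by ring, show 12 * (2 * z) = 24 * z by ring, ss, qq]
  ring

lemma im_addr {z : ℂ} (h : 0 < z.im) {c : ℂ} (hc : c.im = 0) : 0 < (z + c).im := by
  rw [add_im, hc, add_zero]; exact h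

lemma shift_u {z : ℂ} (h : 0 < z.im) : t3 (8 * (z + 1 / 4)) = t3 (8 * z) := by
  rw [show 8 * (z + 1 / 4) = 8 * z + 2 by ring, t3_add_two (im8 h)]

lemma shift_v {z : ℂ} (h : 0 < z.im) : t2 (8 * (z + 1 / 4)) = I * t2 (8 * z) := by
  rw [show 8 * (z + 1 / 4) = 8 * z + 2 by ring, t2_add_two (im8 h)]

lemma shift_U {z : ℂ} (h : 0 < z.im) : t3 (24 * (z + 1 / 4)) = t3 (24 * z) := by
  have h1 : 0 < (24 * z + 2).im := im_addr (im24 h) (by simp)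
  have h2 : 0 < (24 * z + 2 + 2).im := im_addr h1 (by simp)
  rw [show 24 * (z + 1 / 4) = 24 * z + 2 + 2 + 2 by ring, t3_add_two h2, t3_add_two h1,
    t3_add_two (im24 h)]

lemma shift_V {z : ℂ} (h : 0 < z.im) : t2 (24 * (z + 1 / 4)) = -I * t2 (24 * z) := by
  have h1 : 0 < (24 * z + 2).im := im_addr (im24 h) (by simp)
  have h2 : 0 < (24 * z + 2 + 2).im := im_addr h1 (by simp)
  rw [show 24 * (z + 1 / 4) = 24 * z + 2 + 2 + 2 by ring, t2_add_two h2, t2_add_two h1,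
    t2_add_two (im24 h)]
  linear_combination (I * t2 (24 * z)) * I_mul_I

lemma shift_s {z : ℂ} (h : 0 < z.im) : ss (z + 1 / 4) = ss z - qq z := by
  have h1 : 0 < (12 * z + 2).im := im_addr (im12 h) (by simp)
  rw [← ss_sub h, ss, show 4 * (z + 1 / 4) = 4 * z + 1 by ring,
    show 12 * (z + 1 / 4) = 12 * z + 2 + 1 by ring, t3_add_one (im4 h), t3_add_one h1]
  congr 1
  have := t3_add_two (im_addr (im12 h) (c := -1) (by simp))
  have k1 := t3_add_one (im12 h)
  rw [← k1, show 12 * z + 1 = 12 * z + -1 + 2 by ring, this, ← t3_add_one h1]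
  rw [show 12 * z + 2 + 1 = 12 * z + -1 + 2 + 2 by ring, t3_add_two (im_addr (im_addr (im12 h) (c := -1) (by simp)) (by simp)), this]

lemma shift_q {z : ℂ} (h : 0 < z.im) : qq (z + 1 / 4) = - qq z := by
  have h1 : 0 < (12 * z + 1).im := im_addr (im12 h) (by simp)
  rw [qq, show 4 * (z + 1 / 4) = 4 * z + 1 by ring,
    show 12 * (z + 1 / 4) = 12 * z + 1 + 2 by ring, t2_add_one (im4 h), t2_add_two h1,
    t2_add_one (im12 h), qq]
  linear_combination (t2 (4 * z) * t2 (12 * z) * I) * exp_pi_I_half + t2 (4 * z) * t2 (12 * z) * I_mul_I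

set_option linter.unusedSimpArgs false

lemma I_pow3 : I ^ 3 = -I := by rw [pow_succ, I_sq]; ring
lemma I_pow4' : I ^ 4 = 1 := I_pow_four
lemma I_pow5 : I ^ 5 = I := by rw [pow_succ, I_pow_four]; ring
lemma I_pow6 : I ^ 6 = -1 := by rw [pow_succ, I_pow5]; simp
lemma I_pow7 : I ^ 7 = -I := by rw [pow_succ, I_pow6]; ring
lemma I_pow8 : I ^ 8 = 1 := by rw [pow_succ, I_pow7]; simp

lemma shift3 {z : ℂ} (h : 0 < z.im) :
    t3 (8 * (z + 3 / 4)) = t3 (8 * z) ∧ t2 (8 * (z + 3 / 4)) = -I * t2 (8 * z) ∧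
    t3 (24 * (z + 3 / 4)) = t3 (24 * z) ∧ t2 (24 * (z + 3 / 4)) = I * t2 (24 * z) ∧
    ss (z + 3 / 4) = ss z - qq z ∧ qq (z + 3 / 4) = - qq z := by
  have h1 : 0 < (z + 1 / 4).im := im_addr h (by norm_num)
  have h2 : 0 < (z + 1 / 4 + 1 / 4).im := im_addr h1 (by norm_num)
  rw [show z + 3 / 4 = z + 1 / 4 + 1 / 4 + 1 / 4 by ring]
  rw [shift_u h2, shift_u h1, shift_u h, shift_v h2, shift_v h1, shift_v h,
    shift_U h2, shift_U h1, shift_U h, shift_V h2, shift_V h1, shift_V h,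
    shift_s h2, shift_s h1, shift_s h, shift_q h2, shift_q h1, shift_q h]
  refine ⟨rfl, ?_, rfl, ?_, by ring, by ring⟩
  · linear_combination (I * t2 (8 * z)) * I_mul_I
  · linear_combination (-I * t2 (24 * z)) * I_mul_I

/-- Twist of a function by the nontrivial character mod 4. -/
noncomputable def tw (F : ℂ → ℂ) (z : ℂ) : ℂ := (F (z + 1 / 4) - F (z + 3 / 4)) / (2 * I)

lemma im14 {z : ℂ} (h : 0 < z.im) : 0 < (z + 1 / 4).im := im_addr h (by norm_num)
lemma im34 {z : ℂ} (h : 0 < z.im) : 0 < (z + 3 / 4).im := im_addr h (by norm_num)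

lemma two_I_ne : (2 * I) ≠ 0 := by simp

lemma tw_e4 {z : ℂ} (h : 0 < z.im) : tw e4 z =
      (-120)*(t3 (8 * z))*(t2 (8 * z))^7 + 840*(t3 (8 * z))^3*(t2 (8 * z))^5
      + (-840)*(t3 (8 * z))^5*(t2 (8 * z))^3 + 120*(t3 (8 * z))^7*(t2 (8 * z)) := by
  obtain ⟨a, b, c, d, e, f⟩ := shift3 h
  rw [tw, div_eq_iff two_I_ne, e4_1 (im14 h), e4_1 (im34 h), shift_u h, shift_v h, a, b]
  ring_nf
  simp only [I_sq, I_pow3, I_pow4', I_pow5, I_pow6, I_pow7, I_pow8]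
  ring

lemma tw_F6 {z : ℂ} (h : 0 < z.im) : tw F6 z =
      (-1/2)*(t3 (24 * z))*(t2 (24 * z))^3*(t3 (8 * z))^4
      + (1/2)*(t3 (24 * z))*(t2 (24 * z))^3*(t2 (8 * z))^4
      + (-1/2)*(t3 (24 * z))^3*(t2 (24 * z))*(t3 (8 * z))^4
      + (1/2)*(t3 (24 * z))^3*(t2 (24 * z))*(t2 (8 * z))^4
      + (1/2)*(t3 (24 * z))^4*(t3 (8 * z))*(t2 (8 * z))^3
      + (1/2)*(t3 (24 * z))^4*(t3 (8 * z))^3*(t2 (8 * z))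
      + (-1/2)*(t2 (24 * z))^4*(t3 (8 * z))*(t2 (8 * z))^3
      + (-1/2)*(t2 (24 * z))^4*(t3 (8 * z))^3*(t2 (8 * z)) := by
  obtain ⟨a, b, c, d, e, f⟩ := shift3 h
  rw [tw, div_eq_iff two_I_ne, F6_1 (im14 h), F6_1 (im34 h), shift_u h, shift_v h, a, b, shift_U h, shift_V h, c, d]
  ring_nf
  simp only [I_sq, I_pow3, I_pow4', I_pow5, I_pow6, I_pow7, I_pow8]
  ring

lemma tw_F12 {z : ℂ} (h : 0 < z.im) : tw F12 z =
      (-1)*(t3 (24 * z))*(t2 (24 * z))^2*(qq z)*(t3 (8 * z))^2*(t2 (8 * z))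
      + (-1)*(t3 (24 * z))*(t2 (24 * z))^2*(qq z)*(t2 (8 * z))^3
      + (1/2)*(t3 (24 * z))*(t2 (24 * z))^2*(ss z)*(t3 (8 * z))^2*(t2 (8 * z))
      + (1/2)*(t3 (24 * z))*(t2 (24 * z))^2*(ss z)*(t2 (8 * z))^3
      + (t3 (24 * z))^2*(t2 (24 * z))*(qq z)*(t3 (8 * z))*(t2 (8 * z))^2
      + (t3 (24 * z))^2*(t2 (24 * z))*(qq z)*(t3 (8 * z))^3
      + (-1/2)*(t3 (24 * z))^2*(t2 (24 * z))*(ss z)*(t3 (8 * z))*(t2 (8 * z))^2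
      + (-1/2)*(t3 (24 * z))^2*(t2 (24 * z))*(ss z)*(t3 (8 * z))^3
      + (-1)*(t3 (24 * z))^3*(qq z)*(t3 (8 * z))^2*(t2 (8 * z))
      + (-1)*(t3 (24 * z))^3*(qq z)*(t2 (8 * z))^3
      + (1/2)*(t3 (24 * z))^3*(ss z)*(t3 (8 * z))^2*(t2 (8 * z))
      + (1/2)*(t3 (24 * z))^3*(ss z)*(t2 (8 * z))^3
      + (t2 (24 * z))^3*(qq z)*(t3 (8 * z))*(t2 (8 * z))^2
      + (t2 (24 * z))^3*(qq z)*(t3 (8 * z))^3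
      + (-1/2)*(t2 (24 * z))^3*(ss z)*(t3 (8 * z))*(t2 (8 * z))^2
      + (-1/2)*(t2 (24 * z))^3*(ss z)*(t3 (8 * z))^3 := by
  obtain ⟨a, b, c, d, e, f⟩ := shift3 h
  rw [tw, div_eq_iff two_I_ne, F12_1 (im14 h), F12_1 (im34 h), shift_u h, shift_v h, a, b, shift_U h, shift_V h, shift_s h, shift_q h, c, d, e, f]
  ring_nf
  simp only [I_sq, I_pow3, I_pow4', I_pow5, I_pow6, I_pow7, I_pow8]
  ring

lemma tw_F24 {z : ℂ} (h : 0 < z.im) : tw F24 z =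
      (-5/2)*(t3 (24 * z))*(t2 (24 * z))^2*(ss z)*(t3 (8 * z))^2*(t2 (8 * z))
      + (1/2)*(t3 (24 * z))*(t2 (24 * z))^2*(ss z)*(t2 (8 * z))^3
      + (5/2)*(t3 (24 * z))^2*(t2 (24 * z))*(ss z)*(t3 (8 * z))*(t2 (8 * z))^2
      + (-1/2)*(t3 (24 * z))^2*(t2 (24 * z))*(ss z)*(t3 (8 * z))^3
      + (1/2)*(t3 (24 * z))^3*(ss z)*(t3 (8 * z))^2*(t2 (8 * z))
      + (-1/2)*(t3 (24 * z))^3*(ss z)*(t2 (8 * z))^3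
      + (-1/2)*(t2 (24 * z))^3*(ss z)*(t3 (8 * z))*(t2 (8 * z))^2
      + (1/2)*(t2 (24 * z))^3*(ss z)*(t3 (8 * z))^3 := by
  obtain ⟨a, b, c, d, e, f⟩ := shift3 h
  rw [tw, div_eq_iff two_I_ne, F24_1 (im14 h), F24_1 (im34 h), shift_u h, shift_v h, a, b, shift_U h, shift_V h, shift_s h, shift_q h, c, d, e, f]
  ring_nf
  simp only [I_sq, I_pow3, I_pow4', I_pow5, I_pow6, I_pow7, I_pow8]
  ring

lemma odd24 {z : ℂ} (h : 0 < z.im) : (F24 (2 * z) - F24 (2 * z + 1 / 2)) / 2 =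
    (t3 (8 * z) ^ 2 * t3 (24 * z) ^ 2 + t2 (8 * z) ^ 2 * t2 (24 * z) ^ 2) *
    (t2 (8 * z) ^ 2 * t3 (24 * z) ^ 2 - t3 (8 * z) ^ 2 * t2 (24 * z) ^ 2) / 4 := by
  have k := rr_omega (im4 h)
  have t := tt h
  have a := t3_sq (im4 h)
  have b := t3_sq (im12 h)
  rw [show 2 * (4 * z) = 8 * z by ring] at a
  rw [show 2 * (12 * z) = 24 * z by ring] at b
  have s : ss z ^ 2 = (t3 (8 * z) ^ 2 + t2 (8 * z) ^ 2) * (t3 (24 * z) ^ 2 + t2 (24 * z) ^ 2) := by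
    rw [ss, mul_pow, a, b]
  rw [rr, show 2 * (4 * z) = 8 * z by ring, show 6 * (4 * z) = 24 * z by ring,
    show 3 * (4 * z) = 12 * z by ring, ← qq] at k
  rw [show 2 * z + 1 / 2 = 2 * (z + 1 / 4) by ring, F24_2 h, F24_2 (im14 h), shift_u h, shift_v h,
    shift_U h, shift_V h, shift_s h, shift_q h, ← k, t, s]
  linear_combination ((t3 (8 * z) ^ 2 - t2 (8 * z) ^ 2) * (t3 (24 * z) ^ 2 - t2 (24 * z) ^ 2) * qq z *
     t2 (8 * z) * t2 (24 * z) / 8) * I_mul_I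

set_option maxHeartbeats 4000000 in
lemma final_alg (u v U V r s l : ℂ) (hv : v ≠ 0) (hV : V ≠ 0)
    (hu : u = l * (v^2+3*V^2)) (hU : U = 4*v*V*l^3*(v^2+3*V^2)) (hr : r = 4*v*V*l^2*(v^2+3*V^2))
    (hR : 16*v^2*V^2*l^4*(v^2+3*V^2) - (v^2-V^2) = 0)
    (hs : 4*v*V*s = 2*v*V*r + v^4 + 3*V^4) :
    (u+v)^5*(U+V)^2*u = ((14/5)*(16*(u+v)^8-16*(u+v)^4*(u-v)^4+(u-v)^8)
      -(54/5)*(16*(U+V)^8-16*(U+V)^4*(U-V)^4+(U-V)^8)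
      -(238/5)*(u^8+14*u^4*v^4+v^8) + (252/5)*(u^8-u^4*v^4+v^8) + (918/5)*(U^8+14*U^4*V^4+V^8)
      -(448/5)*(u^8-u^4*v^4+v^8/16) - (972/5)*(U^8-U^4*V^4+V^8)
      + (1728/5)*(U^8-U^4*V^4+V^8/16))/240
      + (7/20)*((-120)*u*v^7 + 840*u^3*v^5 + (-840)*u^5*v^3 + 120*u^7*v)/240 + (27/20)*((-120)*U*V^7 + 840*U^3*V^5 + (-840)*U^5*V^3 + 120*U^7*V)/240
      - (4/5)*((u+v)*(u-v)^2*((U+V)*(U-V)^2)*(u*V+v*U)/2)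
      + (16/5)*((u+v)*(u-v)*((U+V)*(U-V))*(u*V+v*U)^2/4)
      - (176/5)*((u*U-v*V)^2*(u*v*(U*V))/4) - (1408/5)*((u*U)*(u*U-v*V)*(v*V)^2/16)
      + (u^4-v^4)*u^2*v^2/4 + 27*((U^4-V^4)*U^2*V^2/4)
      + 4*((u+v)*(u-v)*((U+V)*(U-V))*(u*V+v*U)*(s+r)/2)
      + 20*((u*U)*(u*U-v*V)*(v*V)*(2*s-r)/8)
      + (1/4)*((u^2+v^2)^2*(u*v)*(u^2-v^2)/2) - (27/4)*((U^2+V^2)^2*(U*V)*(U^2-V^2)/2)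
      + 9*((u^2*U^2+v^2*V^2)*(v^2*U^2-u^2*V^2)/4)
      + (22/5)*((-1/2)*U*V^3*u^4 + (1/2)*U*V^3*v^4 + (-1/2)*U^3*V*u^4 + (1/2)*U^3*V*v^4
        + (1/2)*U^4*u*v^3 + (1/2)*U^4*u^3*v + (-1/2)*V^4*u*v^3 + (-1/2)*V^4*u^3*v) + (5/4)*((-1)*U*V^2*r*u^2*v + (-1)*U*V^2*r*v^3 + (1/2)*U*V^2*s*u^2*v + (1/2)*U*V^2*s*v^3
        + U^2*V*r*u*v^2 + U^2*V*r*u^3 + (-1/2)*U^2*V*s*u*v^2 + (-1/2)*U^2*V*s*u^3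
        + (-1)*U^3*r*u^2*v + (-1)*U^3*r*v^3 + (1/2)*U^3*s*u^2*v + (1/2)*U^3*s*v^3 + V^3*r*u*v^2
        + V^3*r*u^3 + (-1/2)*V^3*s*u*v^2 + (-1/2)*V^3*s*u^3) - (9/4)*((-5/2)*U*V^2*s*u^2*v + (1/2)*U*V^2*s*v^3 + (5/2)*U^2*V*s*u*v^2 + (-1/2)*U^2*V*s*u^3
        + (1/2)*U^3*s*u^2*v + (-1/2)*U^3*s*v^3 + (-1/2)*V^3*s*u*v^2 + (1/2)*V^3*s*u^3) := by
  subst hr hU hu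
  refine mul_left_cancel₀ (mul_ne_zero (mul_ne_zero (by norm_num : (4 : ℂ) ≠ 0) hv) hV) ?_
  linear_combination ((22/5)*V*l*v^8 + (121/5)*V*l^2*v^9 + (218/5)*V*l^3*v^10 + (203/5)*V*l^4*v^11
      + (174/5)*V*l^5*v^12 + (131/5)*V*l^6*v^13 + (34/5)*V*l^7*v^14 + (-7/5)*V*l^8*v^15
      + (161/10)*V^3*l*v^6 + (747/5)*V^3*l^2*v^7 + (1593/4)*V^3*l^3*v^8 + (2179/5)*V^3*l^4*v^9
      + (2321/5)*V^3*l^5*v^10 + 561*V^3*l^6*v^11 + (1656/5)*V^3*l^7*v^12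
      + (1073/5)*V^3*l^8*v^13 + (-456/5)*V^3*l^9*v^14 + (-1104/5)*V^3*l^10*v^15
      + (-576/5)*V^3*l^11*v^16 + (-432/5)*V^3*l^12*v^17 + (6/5)*V^5*l*v^4 + 243*V^5*l^2*v^5
      + (12933/10)*V^5*l^3*v^6 + (10053/5)*V^5*l^4*v^7 + 2532*V^5*l^5*v^8
      + (19602/5)*V^5*l^6*v^9 + (17082/5)*V^5*l^7*v^10 + (14349/5)*V^5*l^8*v^11
      + (-1392)*V^5*l^9*v^12 + (-10944/5)*V^5*l^10*v^13 + (-10368/5)*V^5*l^11*v^14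
      + (-5616/5)*V^5*l^12*v^15 + (10368/5)*V^5*l^13*v^16 + (-6912/5)*V^5*l^16*v^19
      + (-45/2)*V^7*l*v^2 + (189/5)*V^7*l^2*v^3 + (8748/5)*V^7*l^3*v^4 + 4725*V^7*l^4*v^5
      + 7182*V^7*l^5*v^6 + (60858/5)*V^7*l^6*v^7 + (69336/5)*V^7*l^7*v^8
      + (88389/5)*V^7*l^8*v^9 + (-7992)*V^7*l^9*v^10 + (-37584/5)*V^7*l^10*v^11
      + (-19008/5)*V^7*l^11*v^12 + (-26352/5)*V^7*l^12*v^13 + (145152/5)*V^7*l^13*v^14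
      + (89856/5)*V^7*l^14*v^15 + (-117504/5)*V^7*l^16*v^17 + (165888/5)*V^7*l^17*v^18
      + (-110592/5)*V^7*l^20*v^21 + (1863/2)*V^9*l^3*v^2 + (23436/5)*V^9*l^4*v^3
      + (53838/5)*V^9*l^5*v^4 + (87399/5)*V^9*l^6*v^5 + (107406/5)*V^9*l^7*v^6
      + (320571/5)*V^9*l^8*v^7 + (-19872)*V^9*l^9*v^8 + (-62208/5)*V^9*l^10*v^9
      + (393984/5)*V^9*l^11*v^10 + (-9072)*V^9*l^12*v^11 + 155520*V^9*l^13*v^12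
      + 269568*V^9*l^14*v^13 + (-808704/5)*V^9*l^16*v^15 + (2985984/5)*V^9*l^17*v^16
      + (-2322432/5)*V^9*l^20*v^19 + (1215/4)*V^11*l^3 + (1944/5)*V^11*l^4*v
      + 6885*V^11*l^5*v^2 + (53217/5)*V^11*l^6*v^3 + (-3888/5)*V^11*l^7*v^4
      + (646947/5)*V^11*l^8*v^5 + (-12312)*V^11*l^9*v^6 + (-143856/5)*V^11*l^10*v^7
      + (2472768/5)*V^11*l^11*v^8 + 3888*V^11*l^12*v^9 + 373248*V^11*l^13*v^10
      + 1617408*V^11*l^14*v^11 + (-559872)*V^11*l^16*v^13 + 4478976*V^11*l^17*v^14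
      + (-20901888/5)*V^11*l^20*v^17 + 2916*V^13*l^6*v + (-112266/5)*V^13*l^7*v^2
      + (561087/5)*V^13*l^8*v^3 + (151632/5)*V^13*l^9*v^4 + (-419904/5)*V^13*l^10*v^5
      + (5505408/5)*V^13*l^11*v^6 + (128304/5)*V^13*l^12*v^7 + 279936*V^13*l^13*v^8
      + 4852224*V^13*l^14*v^9 + (-933120)*V^13*l^16*v^11 + 17915904*V^13*l^17*v^12
      + (-20901888)*V^13*l^20*v^15 + (45927/5)*V^15*l^8*v + 40824*V^15*l^9*v^2
      + (-454896/5)*V^15*l^10*v^3 + (4339008/5)*V^15*l^11*v^4 + (34992/5)*V^15*l^12*v^5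
      + (-1679616/5)*V^15*l^13*v^6 + 7278336*V^15*l^14*v^7 + (-1679616/5)*V^15*l^16*v^9
      + 40310784*V^15*l^17*v^10 + (-62705664)*V^15*l^20*v^13 + (-104976/5)*V^17*l^12*v^3
      + (-2519424/5)*V^17*l^13*v^4 + (21835008/5)*V^17*l^14*v^5 + (5038848/5)*V^17*l^16*v^7
      + (241864704/5)*V^17*l^17*v^8 + (-564350976/5)*V^17*l^20*v^11 + (5038848/5)*V^19*l^16*v^5
      + (120932352/5)*V^19*l^17*v^6 + (-564350976/5)*V^19*l^20*v^9
      + (-241864704/5)*V^21*l^20*v^7) * hR + (5*(4*v*V*l^3*(v^2+3*V^2))*V^2*(l*(v^2+3*V^2))*v^2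
      + (-17/4)*(4*v*V*l^3*(v^2+3*V^2))*V^2*(l*(v^2+3*V^2))^2*v
      + (-3/2)*(4*v*V*l^3*(v^2+3*V^2))*V^2*v^3
      + (33/4)*(4*v*V*l^3*(v^2+3*V^2))^2*V*(l*(v^2+3*V^2))*v^2
      + (-5)*(4*v*V*l^3*(v^2+3*V^2))^2*V*(l*(v^2+3*V^2))^2*v
      + (-5/2)*(4*v*V*l^3*(v^2+3*V^2))^2*V*(l*(v^2+3*V^2))^3
      + (-3/2)*(4*v*V*l^3*(v^2+3*V^2))^3*(l*(v^2+3*V^2))^2*v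
      + (1/4)*(4*v*V*l^3*(v^2+3*V^2))^3*v^3 + (-5/2)*V^3*(l*(v^2+3*V^2))*v^2
      + (15/4)*V^3*(l*(v^2+3*V^2))^3) * hs

/-- `F` has the `q`-expansion with (rational) coefficients `c`. -/
def HS (c : ℕ → ℚ) (F : ℂ → ℂ) : Prop :=
  ∀ z : ℂ, 0 < z.im → HasSum (fun n : ℕ => ((c n : ℚ) : ℂ) * Complex.exp (2 * π * I * z) ^ n) (F z)

lemma HS.add {c d : ℕ → ℚ} {F G : ℂ → ℂ} (hF : HS c F) (hG : HS d G) :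
    HS (fun n => c n + d n) (fun z => F z + G z) := by
  intro z h
  refine ((hF z h).add (hG z h)).congr_fun ?_
  intro n; push_cast; ring

lemma HS.smul {c : ℕ → ℚ} {F : ℂ → ℂ} (hF : HS c F) (k : ℚ) :
    HS (fun n => k * c n) (fun z => (k : ℂ) * F z) := by
  intro z h
  refine ((hF z h).mul_left (k : ℂ)).congr_fun ?_
  intro n; push_cast; ring

lemma HS.unique {c d : ℕ → ℚ} {F G : ℂ → ℂ} (hF : HS c F) (hG : HS d G)
    (h : ∀ z : ℂ, 0 < z.im → F z = G z) (n : ℕ) : c n = d n := by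
  have key := ModularFormClass.qExpansion_coeff_unique (f := (0 : ModularForm (Matrix.SpecialLinearGroup.mapGL ℝ).range 4))
    (c := fun n => ((c n - d n : ℚ) : ℂ)) one_pos one_mem_strictPeriods_SL ?_ n
  · rw [FunLike.coe_zero, UpperHalfPlane.qExpansion_zero, map_zero] at key
    have : c n - d n = 0 := by exact_mod_cast key
    linarith
  · intro τ
    have := (hF τ τ.2).sub (hG τ τ.2)
    rw [h τ τ.2, sub_self] at this
    refine this.congr_fun ?_
    intro m
    simp only [Function.Periodic.qParam, smul_eq_mul, ofReal_one, div_one]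
    push_cast; ring

lemma HS.dv {f : ℕ → ℤ} {F : ℂ → ℂ} (hF : HS (fun n => (f n : ℚ)) F) (k : ℕ) (hk : 0 < k) :
    HS (Dv f k) (fun z => F (k * z)) := by
  intro z h
  have : NeZero k := ⟨hk.ne'⟩
  have h1 := hF _ (im_mul_pos h k)
  have inj : Function.Injective (fun m : ℕ => k * m) := fun a b hab => Nat.eq_of_mul_eq_mul_left hk hab
  refine (inj.hasSum_iff ?_).1 ?_
  · intro x hx
    have : ¬ k ∣ x := by
      rintro ⟨m, rfl⟩
      exact hx ⟨m, rfl⟩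
    simp [Dv, this]
  · refine h1.congr_fun ?_
    intro m
    simp only [Function.comp, Dv, dvd_mul_right, if_true, Nat.mul_div_cancel_left m hk]
    rw [pow_mul, ← Complex.exp_nat_mul (2 * π * I * z) k]
    congr 3
    ring

lemma exp_quarter (z : ℂ) : Complex.exp (2 * π * I * (z + 1 / 4)) = Complex.exp (2 * π * I * z) * I := by
  rw [show 2 * π * I * (z + 1 / 4) = 2 * π * I * z + π / 2 * I by ring, Complex.exp_add,
    Complex.exp_pi_div_two_mul_I]

lemma exp_zhalf (z : ℂ) : Complex.exp (2 * π * I * (z + 1 / 2)) = Complex.exp (2 * π * I * z) * (-1) := by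
  rw [show 2 * π * I * (z + 1 / 2) = 2 * π * I * z + π * I by ring, Complex.exp_add,
    Complex.exp_pi_mul_I]

lemma exp_three (z : ℂ) : Complex.exp (2 * π * I * (z + 3 / 4)) = Complex.exp (2 * π * I * z) * (-I) := by
  rw [show z + 3 / 4 = z + 1 / 4 + 1 / 2 by ring, exp_zhalf, exp_quarter]; ring

lemma chi_I (n : ℕ) : ((chiMinus4 n : ℤ) : ℂ) = (I ^ n - (-I) ^ n) / (2 * I) := by
  have hI : I ≠ 0 := I_ne_zero
  have e : n = 4 * (n / 4) + n % 4 := (Nat.div_add_mod n 4).symm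
  have h1 : I ^ n = I ^ (n % 4) := by
    conv_lhs => rw [e, pow_add, pow_mul, I_pow_four, one_pow, one_mul]
  have h2 : (-I) ^ n = (-I) ^ (n % 4) := by
    conv_lhs => rw [e, pow_add, pow_mul, show (-I) ^ 4 = 1 by rw [neg_pow, I_pow_four]; norm_num,
      one_pow, one_mul]
  have h3 : chiMinus4 n = chiMinus4 (n % 4) := by
    rw [chiMinus4, chiMinus4]
    congr 1
    exact (ZMod.natCast_mod n 4).symm
  rw [h1, h2, h3]
  have : n % 4 < 4 := Nat.mod_lt _ (by norm_num)
  have c0 : chiMinus4 0 = 0 := by decide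
  have c1 : chiMinus4 1 = 1 := by decide
  have c2 : chiMinus4 2 = 0 := by decide
  have c3 : chiMinus4 3 = -1 := by decide
  interval_cases n % 4
  · rw [c0]; simp
  · rw [c1]; field_simp; norm_num
  · rw [c2]; simp
  · rw [c3, div_eq_mul_inv, eq_mul_inv_iff_mul_eq₀ two_I_ne]
    push_cast
    linear_combination (-2 * I) * I_sq

lemma HS.tw {f : ℕ → ℤ} {F : ℂ → ℂ} (hF : HS (fun n => (f n : ℚ)) F) :
    HS (fun n => ((chiMinus4 n * f n : ℤ) : ℚ)) (tw F) := by
  intro z h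
  refine (((hF _ (im14 h)).sub (hF _ (im34 h))).div_const (2 * I)).congr_fun ?_
  intro n
  rw [exp_quarter, exp_three, mul_pow, mul_pow]
  push_cast
  rw [chi_I]
  ring

lemma HS.odd {f : ℕ → ℤ} {F : ℂ → ℂ} (hF : HS (fun n => (f n : ℚ)) F) :
    HS (fun n => ((chi4 n * f n : ℤ) : ℚ)) (fun z => (F z - F (z + 1 / 2)) / 2) := by
  intro z h
  have h2 : 0 < (z + 1 / 2).im := im_addr h (by norm_num)
  refine (((hF _ h).sub (hF _ h2)).div_const 2).congr_fun ?_
  intro n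
  beta_reduce
  rw [exp_zhalf, mul_pow]
  rcases Nat.even_or_odd n with hn | hn
  · rw [hn.neg_one_pow, chi4, if_neg (by rw [Nat.even_iff.1 hn]; norm_num)]
    simp
  · rw [hn.neg_one_pow, chi4, if_pos (Nat.odd_iff.1 hn)]
    push_cast; ring

lemma HS_sigma : HS (fun n => (sigma3 n : ℚ)) (fun z => (e4 z - 1) / 240) := by
  intro z h
  have h1 := e4_hasSum h
  have h2 : HasSum (fun m : ℕ => if m = 0 then (1 : ℂ) else 0) 1 := hasSum_ite_eq 0 1
  refine ((h1.sub h2).div_const 240).congr_fun ?_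
  intro n
  by_cases hn : n = 0
  · subst hn; simp [sigma3]
  · simp [hn]; ring

lemma sigmaChi (n : ℕ) : sigmaChi4Chi4 n = chiMinus4 n * sigma3 n := by
  rw [sigmaChi4Chi4, sigma3, Finset.mul_sum]
  refine Finset.sum_congr rfl fun d hd => ?_
  rw [← map_mul, ← Nat.cast_mul, Nat.mul_div_cancel' (Nat.dvd_of_mem_divisors hd), chiMinus4]

lemma HS_sigmaChi : HS (fun n => (sigmaChi4Chi4 n : ℚ)) (fun z => tw e4 z / 240) := by
  intro z h
  have := HS_sigma.tw z h
  simp only [← sigmaChi] at this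
  convert this using 1
  simp only [tw]; ring

lemma HS_one : HS (fun n => if n = 0 then 1 else 0) (fun _ => 1) := by
  intro z h
  refine (hasSum_ite_eq 0 (1 : ℂ)).congr_fun ?_
  intro n
  by_cases hn : n = 0
  · subst hn; simp
  · simp [hn]

lemma HS_a (a : ℕ → ℤ) (F : ℂ → ℂ)
    (hF : ∀ z : ℂ, 0 < z.im → F z = ∑' m : ℕ, (a (m + 1) : ℂ) * Complex.exp (2 * π * I * z) ^ (m + 1))
    (hne : ∀ y : ℝ, 0 < y → F (y * I) ≠ 0) :
    HS (fun n => ((if n = 0 then 0 else a n : ℤ) : ℚ)) F := by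
  intro z h
  set q := Complex.exp (2 * π * I * z) with hq
  have hy : 0 < z.im / 2 := by linarith
  set w : ℂ := ((z.im / 2 : ℝ) : ℂ) * I with hw
  have hwim : w.im = z.im / 2 := by simp [hw]
  have s0 : Summable (fun m : ℕ => (a (m + 1) : ℂ) * Complex.exp (2 * π * I * w) ^ (m + 1)) := by
    by_contra hs
    exact hne _ hy (by rw [← hw, hF w (by rw [hwim]; exact hy), tsum_eq_zero_of_not_summable hs])
  have hlt : ‖q‖ < ‖Complex.exp (2 * π * I * w)‖ := by
    rw [hq, Complex.norm_exp, Complex.norm_exp]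
    apply Real.exp_lt_exp.2
    have := Real.pi_pos
    simp [hwim]
    nlinarith
  have s1 : Summable (fun m : ℕ => (a (m + 1) : ℂ) * q ^ (m + 1)) := by
    refine Summable.of_norm_bounded (g := fun m => ‖(a (m + 1) : ℂ) * Complex.exp (2 * π * I * w) ^ (m + 1)‖) s0.norm ?_
    intro m
    rw [norm_mul, norm_mul, norm_pow, norm_pow]
    gcongr
  have s2 := s1.hasSum
  rw [← hF z h] at s2
  refine (hasSum_nat_add_iff' 1).1 ?_
  simp only [Finset.range_one, Finset.sum_singleton]
  refine (s2.congr_fun ?_).trans_eq ?_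
  · intro m; simp
  · simp

lemma hasSum_pi_prod : ∀ (k : ℕ) (f : Fin k → ℤ → ℂ) (s : Fin k → ℂ), (∀ i, HasSum (f i) (s i)) →
    HasSum (fun x : Fin k → ℤ => ∏ i, f i (x i)) (∏ i, s i)
  | 0, f, s, _ => by
    simp only [Finset.univ_eq_empty, Finset.prod_empty]
    exact hasSum_unique _
  | k + 1, f, s, h => by
    have ih := hasSum_pi_prod k (fun i => f i.succ) (fun i => s i.succ) (fun i => h i.succ)
    have h2 := hasSum_mul (h 0) ih
    rw [Fin.prod_univ_succ]
    refine ((Fin.consEquiv (fun _ : Fin (k + 1) => ℤ)).hasSum_iff).1 ?_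
    refine h2.congr_fun ?_
    intro p
    simp [Fin.prod_univ_succ, Fin.consEquiv]

lemma theta_term (z : ℂ) (k : ℕ) (n : ℤ) :
    ee (2 * k * z) ((n : ℂ) ^ 2) = Complex.exp (2 * π * I * z) ^ (k * n.natAbs ^ 2) := by
  rw [ee, ← Complex.exp_nat_mul]
  congr 1
  have : ((n.natAbs : ℂ)) ^ 2 = (n : ℂ) ^ 2 := by
    rw [← Int.cast_natCast, ← Int.cast_pow, Int.natAbs_sq, Int.cast_pow]
  push_cast
  rw [this]; ring

lemma HS_rep : HS (fun n => (repCount ![1, 1, 1, 1, 1, 3, 3, 4] n : ℚ))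
    (fun z => t3 (2 * z) ^ 5 * t3 (6 * z) ^ 2 * t3 (8 * z)) := by
  intro z h
  set a : Fin 8 → ℕ := ![1, 1, 1, 1, 1, 3, 3, 4] with ha
  have hk : ∀ k : ℕ, 0 < k → HasSum (fun n : ℤ => Complex.exp (2 * π * I * z) ^ (k * n.natAbs ^ 2))
      (t3 (2 * k * z)) := by
    intro k hk
    have : NeZero k := ⟨hk.ne'⟩
    have h1 : 0 < (2 * k * z).im := by
      rw [mul_assoc]; exact im2 (im_mul_pos h k)
    exact (hs3 h1).congr_fun fun n => (theta_term z k n).symm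
  have hpos : ∀ i, 0 < a i := by
    intro i; fin_cases i <;> simp [ha]
  have h1 := hasSum_pi_prod 8 _ _ (fun i => hk (a i) (hpos i))
  have h2 : ∏ i, t3 (2 * (a i : ℂ) * z) = t3 (2 * z) ^ 5 * t3 (6 * z) ^ 2 * t3 (8 * z) := by
    simp only [Fin.prod_univ_eight, ha]
    simp only [Matrix.cons_val]
    norm_num only [Nat.cast_one, Nat.cast_ofNat]
    ring
  rw [h2] at h1
  let N : (Fin 8 → ℤ) → ℕ := fun x => ∑ i, a i * (x i).natAbs ^ 2
  have h3 : HasSum (fun x : Fin 8 → ℤ => Complex.exp (2 * π * I * z) ^ N x)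
      (t3 (2 * z) ^ 5 * t3 (6 * z) ^ 2 * t3 (8 * z)) := by
    refine h1.congr_fun fun x => ?_
    rw [Finset.prod_pow_eq_pow_sum]
  have h4 := ((Equiv.sigmaFiberEquiv N).hasSum_iff).2 h3
  have h5 := h4.sigma (fun n => (h4.summable.sigma_factor n).hasSum)
  refine h5.congr_fun fun n => ?_
  have h6 : ∀ c : {x // N x = n}, ((fun x : Fin 8 → ℤ => Complex.exp (2 * π * I * z) ^ N x) ∘
      (Equiv.sigmaFiberEquiv N)) ⟨n, c⟩ = Complex.exp (2 * π * I * z) ^ n := by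
    rintro ⟨x, hx⟩
    simp [Equiv.sigmaFiberEquiv, hx]
  rw [tsum_congr h6, tsum_const, nsmul_eq_mul]
  congr 1
  rw [Rat.cast_natCast]
  congr 1
  rw [repCount]
  refine Nat.card_congr (Equiv.subtypeEquivRight fun x => ?_)
  rw [← Nat.cast_inj (R := ℤ)]
  have : ((N x : ℕ) : ℤ) = ∑ i, (a i : ℤ) * x i ^ 2 := by
    simp only [N]
    push_cast
    simp
  rw [this]

lemma t3_real (y : ℝ) (hy : 0 < y) : ∃ r : ℝ, r ≠ 0 ∧ t3 (y * I) = r := by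
  have him : 0 < ((y : ℂ) * I).im := by simpa using hy
  have h := hs3 him
  have e : ∀ n : ℤ, ee (y * I) ((n : ℂ) ^ 2) = ((Real.exp (-π * n ^ 2 * y) : ℝ) : ℂ) := by
    intro n
    rw [ee]; push_cast
    congr 1
    linear_combination (π * n ^ 2 * y : ℂ) * I_mul_I
  have k : t3 (y * I) = ((∑' n : ℤ, Real.exp (-π * n ^ 2 * y) : ℝ) : ℂ) := by
    rw [Complex.ofReal_tsum, ← h.tsum_eq]
    exact tsum_congr e
  refine ⟨_, ?_, k⟩
  intro h0
  rw [h0] at k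
  exact t3_ne him (by simpa using k)

lemma imI {y : ℝ} (hy : 0 < y) : 0 < ((y : ℂ) * I).im := by simpa using hy

lemma F6_ne {z : ℂ} (h : 0 < z.im) : F6 z ≠ 0 := by
  rw [F6]
  simp [t3_ne (im2 h), t3_ne (im6 h), t4_ne (im2 h), t4_ne (im6 h), t2_ne (im2 h), t2_ne (im6 h)]

lemma F8_ne {z : ℂ} (h : 0 < z.im) : F8 z ≠ 0 := by
  rw [F8]
  simp [t3_ne (im4 h), t4_ne (im4 h), t2_ne (im4 h)]

lemma F16_ne {z : ℂ} (h : 0 < z.im) : F16 z ≠ 0 := by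
  rw [F16]
  simp [t3_ne (im4 h), t4_ne (im8 h), t2_ne (im8 h), t3_ne (im8 h)]

lemma F24_ne {z : ℂ} (h : 0 < z.im) : F24 z ≠ 0 := by
  rw [F24]
  simp [t3_ne (im2 h), t3_ne (im6 h), t2_ne (im2 h), t2_ne (im6 h), t4_ne (im4 h), t4_ne (im12 h)]

lemma F12_ne (y : ℝ) (hy : 0 < y) : F12 (y * I) ≠ 0 := by
  have h := imI hy
  have a := aa_two h
  obtain ⟨r, hr, e⟩ := t3_real (2 * y) (by linarith)
  obtain ⟨s, hs, f⟩ := t3_real (6 * y) (by linarith)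
  have k : t3 (2 * (y * I)) ^ 4 + 3 * t3 (6 * (y * I)) ^ 4 ≠ 0 := by
    rw [show 2 * ((y : ℂ) * I) = ((2 * y : ℝ) : ℂ) * I by push_cast; ring, e,
      show 6 * ((y : ℂ) * I) = ((6 * y : ℝ) : ℂ) * I by push_cast; ring, f]
    have : r ^ 4 + 3 * s ^ 4 ≠ 0 := by positivity
    exact_mod_cast this
  rw [a] at k
  have k2 := right_ne_zero_of_mul k
  rw [F12]
  simp [t3_ne (im2 h), t3_ne (im6 h), t4_ne (im2 h), t4_ne (im6 h), t2_ne (im2 h), t2_ne (im6 h), k2]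

lemma caps {z : ℂ} : (8 * (3 * z) = 24 * z) ∧ (4 * (3 * z) = 12 * z) ∧ (16 * (3 * z) = 48 * z) ∧
    (2 * (3 * z) = 6 * z) := by
  refine ⟨?_, ?_, ?_, ?_⟩ <;> ring

set_option maxHeartbeats 4000000 in
lemma master {z : ℂ} (h : 0 < z.im) :
    t3 (2 * z) ^ 5 * t3 (6 * z) ^ 2 * t3 (8 * z) =
      ((14/5) * e4 z - (54/5) * e4 (3 * z) - (238/5) * e4 (4 * z) + (252/5) * e4 (8 * z)
        + (918/5) * e4 (12 * z) - (448/5) * e4 (16 * z) - (972/5) * e4 (24 * z)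
        + (1728/5) * e4 (48 * z)) / 240
      + (7/20) * tw e4 z / 240 + (27/20) * tw e4 (3 * z) / 240
      - (4/5) * F6 z + (16/5) * F6 (2 * z) - (176/5) * F6 (4 * z) - (1408/5) * F6 (8 * z)
      + F8 (2 * z) + 27 * F8 (6 * z) + 4 * F12 z + 20 * F12 (4 * z)
      + (1/4) * F16 z - (27/4) * F16 (3 * z)
      + 9 * ((F24 (2 * z) - F24 (2 * z + 1 / 2)) / 2)
      + (22/5) * tw F6 z + (5/4) * tw F12 z - (9/4) * tw F24 z := by
  obtain ⟨l, he, p1, p2, p3, p4, p5⟩ := param (im4 h)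
  have h3 := im3 h
  obtain ⟨c8, c4, c16, c2⟩ := caps (z := z)
  have r1 := e4_1 h3
  have r4 := e4_4 h3
  have r8 := e4_8 h3
  have r16 := e4_16 h3
  have rt := tw_e4 h3
  have rf8 := F8_2 h3
  have rf16 := F16_1 h3
  rw [c8] at r1 r4 r8 r16 rt rf8 rf16
  rw [c4] at r4
  rw [c16] at r16
  rw [c2] at rf8
  rw [rr, show 2 * (4 * z) = 8 * z by ring, show 6 * (4 * z) = 24 * z by ring,
    show 3 * (4 * z) = 12 * z by ring, ← qq] at *
  rw [(base_rels h).1, (base_rels h).2.2.1, e4_1 h, r1, e4_4 h, e4_8 h, r4, e4_16 h, r8, r16,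
    tw_e4 h, rt, F6_1 h, F6_2' h, F6_4 h, F6_8 h, F8_2 h, rf8, F12_1 h, F12_4 h, F16_1 h, rf16,
    odd24 h, tw_F6 h, tw_F12 h, tw_F24 h]
  exact final_alg _ _ _ _ _ _ l (t2_ne (im8 h)) (t2_ne (im24 h)) p1 p2 p3 p4 p5

theorem representation_formula_12
    (a6 a8 a12 a16 a24 : ℕ → ℤ)
    (ha6 : ∀ z : ℂ, 0 < z.im →
      dedekindEta z ^ (2 : ℤ) * dedekindEta (2 * z) ^ (2 : ℤ) * dedekindEta (3 * z) ^ (2 : ℤ) * dedekindEta (6 * z) ^ (2 : ℤ)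
        = ∑' m : ℕ, (a6 (m + 1) : ℂ) * Complex.exp (2 * Real.pi * Complex.I * z) ^ (m + 1))
    (ha8 : ∀ z : ℂ, 0 < z.im →
      dedekindEta (2 * z) ^ (4 : ℤ) * dedekindEta (4 * z) ^ (4 : ℤ)
        = ∑' m : ℕ, (a8 (m + 1) : ℂ) * Complex.exp (2 * Real.pi * Complex.I * z) ^ (m + 1))
    (ha12 : ∀ z : ℂ, 0 < z.im →
      dedekindEta z ^ (-1 : ℤ) * dedekindEta (2 * z) ^ (2 : ℤ) * dedekindEta (3 * z) ^ (3 : ℤ) * dedekindEta (4 * z) ^ (3 : ℤ) *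
            dedekindEta (6 * z) ^ (2 : ℤ) * dedekindEta (12 * z) ^ (-1 : ℤ) -
          dedekindEta z ^ (3 : ℤ) * dedekindEta (2 * z) ^ (2 : ℤ) * dedekindEta (3 * z) ^ (-1 : ℤ) *
            dedekindEta (4 * z) ^ (-1 : ℤ) * dedekindEta (6 * z) ^ (2 : ℤ) * dedekindEta (12 * z) ^ (3 : ℤ)
        = ∑' m : ℕ, (a12 (m + 1) : ℂ) * Complex.exp (2 * Real.pi * Complex.I * z) ^ (m + 1))
    (ha16 : ∀ z : ℂ, 0 < z.im →
      dedekindEta (2 * z) ^ (-4 : ℤ) * dedekindEta (4 * z) ^ (16 : ℤ) * dedekindEta (8 * z) ^ (-4 : ℤ)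
        = ∑' m : ℕ, (a16 (m + 1) : ℂ) * Complex.exp (2 * Real.pi * Complex.I * z) ^ (m + 1))
    (ha24 : ∀ z : ℂ, 0 < z.im →
      dedekindEta z ^ (-4 : ℤ) * dedekindEta (2 * z) ^ (11 : ℤ) * dedekindEta (3 * z) ^ (-4 : ℤ) *
          dedekindEta (4 * z) ^ (-3 : ℤ) * dedekindEta (6 * z) ^ (11 : ℤ) * dedekindEta (12 * z) ^ (-3 : ℤ)
        = ∑' m : ℕ, (a24 (m + 1) : ℂ) * Complex.exp (2 * Real.pi * Complex.I * z) ^ (m + 1))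
    (n : ℕ) (hn : 0 < n) :
    (repCount ![1, 1, 1, 1, 1, 3, 3, 4] n : ℚ) =
    (((14 : ℚ) / 5) * (sigma3 n : ℚ)
      + ((-54 : ℚ) / 5) * Dv sigma3 3 n
      + ((-238 : ℚ) / 5) * Dv sigma3 4 n
      + ((252 : ℚ) / 5) * Dv sigma3 8 n
      + ((918 : ℚ) / 5) * Dv sigma3 12 n
      + ((-448 : ℚ) / 5) * Dv sigma3 16 n
      + ((-972 : ℚ) / 5) * Dv sigma3 24 n
      + ((1728 : ℚ) / 5) * Dv sigma3 48 n
      + ((7 : ℚ) / 20) * (sigmaChi4Chi4 n : ℚ)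
      + ((27 : ℚ) / 20) * Dv sigmaChi4Chi4 3 n
      + ((-4 : ℚ) / 5) * (a6 n : ℚ)
      + ((16 : ℚ) / 5) * Dv a6 2 n
      + ((-176 : ℚ) / 5) * Dv a6 4 n
      + ((-1408 : ℚ) / 5) * Dv a6 8 n
      + (1 : ℚ) * Dv a8 2 n
      + (27 : ℚ) * Dv a8 6 n
      + (4 : ℚ) * (a12 n : ℚ)
      + (20 : ℚ) * Dv a12 4 n
      + ((1 : ℚ) / 4) * (a16 n : ℚ)
      + ((-27 : ℚ) / 4) * Dv a16 3 n
      + (9 : ℚ) * Dv (fun m => chi4 m * a24 m) 2 n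
      + ((22 : ℚ) / 5) * ((chiMinus4 n * a6 n : ℤ) : ℚ)
      + ((5 : ℚ) / 4) * ((chiMinus4 n * a12 n : ℤ) : ℚ)
      + ((-9 : ℚ) / 4) * ((chiMinus4 n * a24 n : ℤ) : ℚ)) := by
  set b6 : ℕ → ℤ := fun n => if n = 0 then 0 else a6 n with hb6
  set b8 : ℕ → ℤ := fun n => if n = 0 then 0 else a8 n with hb8
  set b12 : ℕ → ℤ := fun n => if n = 0 then 0 else a12 n with hb12
  set b16 : ℕ → ℤ := fun n => if n = 0 then 0 else a16 n with hb16
  set b24 : ℕ → ℤ := fun n => if n = 0 then 0 else a24 n with hb24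
  have k6 : HS (fun n => (b6 n : ℚ)) F6 := HS_a a6 F6 (fun z h => (F6_eq h).symm.trans (ha6 z h))
    (fun y hy => F6_ne (imI hy))
  have k8 : HS (fun n => (b8 n : ℚ)) F8 := HS_a a8 F8 (fun z h => (F8_eq h).symm.trans (ha8 z h))
    (fun y hy => F8_ne (imI hy))
  have k12 : HS (fun n => (b12 n : ℚ)) F12 :=
    HS_a a12 F12 (fun z h => (F12_eq h).symm.trans (ha12 z h)) F12_ne
  have k16 : HS (fun n => (b16 n : ℚ)) F16 :=
    HS_a a16 F16 (fun z h => (F16_eq h).symm.trans (ha16 z h)) (fun y hy => F16_ne (imI hy))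
  have k24 : HS (fun n => (b24 n : ℚ)) F24 :=
    HS_a a24 F24 (fun z h => (F24_eq h).symm.trans (ha24 z h)) (fun y hy => F24_ne (imI hy))
  have big := (((((((((((((((((((((((HS_one.add
    (HS_sigma.smul (14 / 5))).add
    ((HS_sigma.dv 3 (by norm_num)).smul (-54 / 5))).add
    ((HS_sigma.dv 4 (by norm_num)).smul (-238 / 5))).add
    ((HS_sigma.dv 8 (by norm_num)).smul (252 / 5))).add
    ((HS_sigma.dv 12 (by norm_num)).smul (918 / 5))).add
    ((HS_sigma.dv 16 (by norm_num)).smul (-448 / 5))).add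
    ((HS_sigma.dv 24 (by norm_num)).smul (-972 / 5))).add
    ((HS_sigma.dv 48 (by norm_num)).smul (1728 / 5))).add
    (HS_sigmaChi.smul (7 / 20))).add
    ((HS_sigmaChi.dv 3 (by norm_num)).smul (27 / 20))).add
    (k6.smul (-4 / 5))).add
    ((k6.dv 2 (by norm_num)).smul (16 / 5))).add
    ((k6.dv 4 (by norm_num)).smul (-176 / 5))).add
    ((k6.dv 8 (by norm_num)).smul (-1408 / 5))).add
    ((k8.dv 2 (by norm_num)).smul (1))).add
    ((k8.dv 6 (by norm_num)).smul (27))).add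
    (k12.smul 4)).add
    ((k12.dv 4 (by norm_num)).smul 20)).add
    (k16.smul (1 / 4))).add
    ((k16.dv 3 (by norm_num)).smul (-27 / 4))).add
    ((k24.odd.dv 2 (by norm_num)).smul 9)).add
    (k6.tw.smul (22 / 5))).add
    (k12.tw.smul (5 / 4))).add
    (k24.tw.smul (-9 / 4))
  have key := HS.unique HS_rep big (fun z h => by
    simp only [master h]
    push_cast
    ring) n
  have hn0 : n ≠ 0 := hn.ne'
  have hD : ∀ (a : ℕ → ℤ) (k : ℕ), Dv (fun n => if n = 0 then 0 else a n) k n = Dv a k n := by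
    intro a k
    rw [Dv, Dv]
    by_cases hk : k ∣ n
    · rw [if_pos hk, if_pos hk, if_neg]
      exact (Nat.div_pos (Nat.le_of_dvd hn hk) (Nat.pos_of_dvd_of_pos hk hn)).ne'
    · rw [if_neg hk, if_neg hk]
  have hD2 : Dv (fun m => chi4 m * b24 m) 2 n = Dv (fun m => chi4 m * a24 m) 2 n := by
    rw [← hD (fun m => chi4 m * a24 m) 2]
    congr 1
    funext m
    by_cases hm : m = 0 <;> simp [hb24, hm]
  have e6 : b6 n = a6 n := if_neg hn0
  have e12 : b12 n = a12 n := if_neg hn0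
  have e16 : b16 n = a16 n := if_neg hn0
  have e24 : b24 n = a24 n := if_neg hn0
  rw [if_neg hn0, hD2, e6, e12, e16, e24, hb6, hb8, hb12, hb16, hD, hD, hD, hD, hD, hD, hD] at key
  linarith
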